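/- arXiv:2203.03533 — 3 statements merged into one kernel-verified Lean document; each statement's English description precedes it below -/
import Mathlib

section
/- The group X₀(17)(Q(√318049)) of Q(√318049)-rational points of the modular curve X₀(17), where 318049 = 47 · 67 · 101, has exactly 4 elements and coincides with the group X₀(17)(Q) of rational points. -/
open Polynomial IntermediateField NumberField

/-- The modular curve `X₀(11)`: the elliptic curve `y² + y = x³ - x² - 10x - 20`
(Cremona label 11a1), with coefficients in the field `K`. -/
noncomputable def X0_11 (K : Type*) [Field K] : WeierstrassCurve.Affine K :=
  { a₁ := 0, a₂ := -1, a₃ := 1, a₄ := -10, a₆ := -20 }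

/-- The modular curve `X₀(17)`: the elliptic curve `y² + xy + y = x³ - x² - x - 14`
(Cremona label 17a1), with coefficients in the field `K`. -/
noncomputable def X0_17 (K : Type*) [Field K] : WeierstrassCurve.Affine K :=
  { a₁ := 1, a₂ := -1, a₃ := 1, a₄ := -1, a₆ := -14 }

/-- The modular curve `X₀(19)`: the elliptic curve `y² + y = x³ + x² - 9x - 15`
(Cremona label 19a3), with coefficients in the field `K`. -/
noncomputable def X0_19 (K : Type*) [Field K] : WeierstrassCurve.Affine K :=
  { a₁ := 0, a₂ := 1, a₃ := 1, a₄ := -9, a₆ := -15 }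

/-- Every `K`-point of the Weierstrass curve `W` has both coordinates in the image of `ℚ`,
i.e. `W(K)` coincides with the group of rational points `W(ℚ)`. -/
def PointsRational {K : Type*} [Field K] [CharZero K] (W : WeierstrassCurve.Affine K) : Prop :=
  ∀ x y : K, W.Nonsingular x y → (∃ a : ℚ, (a : K) = x) ∧ ∃ b : ℚ, (b : K) = y

theorem int_of_sqfree {D : ℤ} (hD : Squarefree D) {r : ℚ} {n : ℤ} (h : (D : ℚ) * r ^ 2 = n) :
    ∃ k : ℤ, r = k := by
  have hden : (r.den : ℚ) ≠ 0 := by exact_mod_cast r.den_nz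
  have h1 : D * r.num ^ 2 = n * (r.den : ℤ) ^ 2 := by
    have : (D : ℚ) * (r.num : ℚ) ^ 2 = n * (r.den : ℚ) ^ 2 := by
      rw [← h]
      conv_rhs => rw [← Rat.num_div_den r]
      field_simp
      rw [Rat.num_div_den]
    exact_mod_cast this
  have hc : IsCoprime ((r.den : ℤ) ^ 2) (r.num ^ 2) := by
    have := r.reduced
    have h2 : IsCoprime r.num (r.den : ℤ) := by
      rw [Int.isCoprime_iff_nat_coprime]; simpa using this
    exact (h2.symm).pow
  have h3 : (r.den : ℤ) ^ 2 ∣ D := by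
    apply hc.dvd_of_dvd_mul_right
    rw [h1]; exact Dvd.intro_left n rfl
  have h4 : IsUnit (r.den : ℤ) := hD _ (by rw [← sq]; exact h3)
  have h5 : r.den = 1 := by
    have := Int.isUnit_iff.mp h4
    omega
  exact ⟨r.num, by rw [← Rat.num_div_den r]; simp [h5]⟩

theorem sqfree_part (n : ℤ) (hn : n ≠ 0) : ∃ c s : ℤ, Squarefree c ∧ n = c * s ^ 2 ∧ s ≠ 0 := by
  obtain ⟨a, b, hab, hs⟩ := Nat.sq_mul_squarefree n.natAbs
  have hb : (b : ℤ) ≠ 0 := by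
    intro h
    have : b = 0 := by exact_mod_cast h
    subst this
    simp at hab
    omega
  have hs' : Squarefree (a : ℤ) := by
    rw [← Int.squarefree_natAbs]; simpa using hs
  have h2 : (b : ℤ) ^ 2 * a = |n| := by
    rw [Int.abs_eq_natAbs]; exact_mod_cast hab
  rcases abs_choice n with h | h
  · exact ⟨a, b, hs', by rw [← h, ← h2]; ring, hb⟩
  · refine ⟨-a, b, ?_, ?_, hb⟩
    · rw [← Int.squarefree_natAbs]; simpa using hs
    · have : n = -|n| := by rw [h]; ring
      rw [this, ← h2]; ring

theorem natAbs_dvd_of_sqfree {c : ℤ} (hc : Squarefree c) {M : ℕ}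
    (h : ∀ q : ℕ, q.Prime → (q : ℤ) ∣ c → q ∣ M) : c.natAbs ∣ M := by
  have hs : Squarefree c.natAbs := Int.squarefree_natAbs.mpr hc
  rw [← Nat.prod_primeFactors_of_squarefree hs]
  apply Finset.prod_primes_dvd
  · intro a ha
    exact (Nat.prime_of_mem_primeFactors ha).prime
  · intro a ha
    exact h a (Nat.prime_of_mem_primeFactors ha)
      (Int.natCast_dvd.mpr (Nat.dvd_of_mem_primeFactors ha))

theorem dvd_list {p : ℕ} (hp : p.Prime) {M : ℕ} {l : List ℕ} (h : ∀ n, n ∣ M → n ∈ l) :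
    ∀ n, n ∣ p * M → n ∈ l ++ l.map (p * ·) := by
  intro n hn
  by_cases hpn : p ∣ n
  · obtain ⟨k, rfl⟩ := hpn
    have : k ∣ M := Nat.dvd_of_mul_dvd_mul_left hp.pos hn
    simp only [List.mem_append, List.mem_map]
    exact Or.inr ⟨k, h k this, rfl⟩
  · have hcop : Nat.Coprime n p := ((Nat.Prime.coprime_iff_not_dvd hp).mpr hpn).symm
    simp only [List.mem_append]
    exact Or.inl (h n (hcop.dvd_of_dvd_mul_left hn))

theorem dvd_list_one : ∀ n : ℕ, n ∣ 1 → n ∈ [1] := by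
  intro n hn; simpa using hn

theorem sqclass (D a b : ℤ) {u v : ℚ} (hu : u ≠ 0) (h : D * v ^ 2 = u * (u ^ 2 + a * u + b)) :
    ∃ α : ℤ, Squarefree α ∧ (∀ q : ℕ, q.Prime → (q : ℤ) ∣ α → (q : ℤ) ∣ D * b) ∧
      ∃ r : ℚ, r ≠ 0 ∧ u = α * r ^ 2 := by
  have hX : u.num ≠ 0 := Rat.num_ne_zero.mpr hu
  have hY : (u.den : ℤ) ≠ 0 := by exact_mod_cast u.den_nz
  have hcop : IsCoprime u.num (u.den : ℤ) := by
    rw [Int.isCoprime_iff_nat_coprime]; simpa using u.reduced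
  have hu' : u = (u.num : ℚ) / ((u.den : ℤ) : ℚ) := by
    conv_lhs => rw [← Rat.num_div_den u]
    simp
  generalize u.num = X at *
  generalize (u.den : ℤ) = Y at *
  have hXq : (X : ℚ) ≠ 0 := by exact_mod_cast hX
  have hYq : (Y : ℚ) ≠ 0 := by exact_mod_cast hY
  obtain ⟨α, s, hα, hs, hs0⟩ := sqfree_part (X * Y) (mul_ne_zero hX hY)
  have hsq : (s : ℚ) ≠ 0 := by exact_mod_cast hs0
  have hsQ : (X : ℚ) * Y = α * s ^ 2 := by exact_mod_cast hs
  refine ⟨α, hα, ?_, s / Y, div_ne_zero hsq hYq, ?_⟩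
  · intro q hq hqα
    by_contra hqb
    have hqp : Prime (q : ℤ) := Nat.prime_iff_prime_int.mp hq
    have hqD : ¬ (q : ℤ) ∣ D := fun hh => hqb (hh.mul_right b)
    have hqb' : ¬ (q : ℤ) ∣ b := fun hh => hqb (hh.mul_left D)
    have hG : ((1 : ℤ) : ℚ) * (D * v * Y ^ 2 / s) ^ 2
        = ((D * α * (X ^ 2 + a * (X * Y) + b * Y ^ 2) : ℤ) : ℚ) := by
      have h2 : D * v ^ 2 * Y ^ 4 = X * Y * (X ^ 2 + a * (X * Y) + b * Y ^ 2) := by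
        rw [h, hu']; field_simp
      push_cast
      field_simp
      linear_combination D * h2 + D * (X ^ 2 + a * (X * Y) + b * Y ^ 2) * hsQ
    obtain ⟨G, hGG⟩ := int_of_sqfree squarefree_one hG
    rw [hGG] at hG
    have hG' : G ^ 2 = D * α * (X ^ 2 + a * (X * Y) + b * Y ^ 2) := by
      have : (1 : ℤ) * G ^ 2 = D * α * (X ^ 2 + a * (X * Y) + b * Y ^ 2) := by exact_mod_cast hG
      linarith
    obtain ⟨α', rfl⟩ := hqα
    have hqG : (q : ℤ) ∣ G := by
      apply hqp.dvd_of_dvd_pow (n := 2)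
      rw [hG']; exact ⟨D * α' * (X ^ 2 + a * (X * Y) + b * Y ^ 2), by ring⟩
    obtain ⟨G', rfl⟩ := hqG
    have hq0 : (q : ℤ) ≠ 0 := hqp.ne_zero
    have h5 : (q : ℤ) * G' ^ 2 = D * α' * (X ^ 2 + a * (X * Y) + b * Y ^ 2) := by
      apply mul_left_cancel₀ hq0
      linear_combination hG'
    have h6 : (q : ℤ) ∣ D * α' * (X ^ 2 + a * (X * Y) + b * Y ^ 2) := ⟨_, h5.symm⟩
    have hXY : (q : ℤ) ∣ X * Y := by rw [hs]; exact ⟨α' * s ^ 2, by ring⟩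
    have hnot : ¬ ((q : ℤ) ∣ X ∧ (q : ℤ) ∣ Y) := fun ⟨h1, h2⟩ =>
      hqp.not_isUnit (hcop.isUnit_of_dvd' h1 h2)
    rcases hqp.dvd_or_dvd h6 with h7 | h7
    · rcases hqp.dvd_or_dvd h7 with h8 | h8
      · exact hqD h8
      · exact hqp.not_isUnit (hα _ (mul_dvd_mul_left _ h8))
    · have h9 : (q : ℤ) ∣ X ^ 2 + b * Y ^ 2 := by
        have := dvd_sub h7 (hXY.mul_left a)
        have e : X ^ 2 + a * (X * Y) + b * Y ^ 2 - a * (X * Y) = X ^ 2 + b * Y ^ 2 := by ring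
        rwa [e] at this
      rcases hqp.dvd_or_dvd hXY with h8 | h8
      · have : (q : ℤ) ∣ b * Y ^ 2 := (dvd_add_right (dvd_pow h8 two_ne_zero)).mp h9
        rcases hqp.dvd_or_dvd this with h10 | h10
        · exact hqb' h10
        · exact hnot ⟨h8, hqp.dvd_of_dvd_pow h10⟩
      · have : (q : ℤ) ∣ X ^ 2 :=
          (dvd_add_left ((dvd_pow h8 two_ne_zero).mul_left b)).mp h9
        exact hnot ⟨hqp.dvd_of_dvd_pow this, h8⟩
  · rw [hu']; field_simp; linear_combination hsQ

/-- integral model -/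
theorem integral_model {D a b α : ℤ} (hD : Squarefree D) {u v r : ℚ} (hr : r ≠ 0)
    (hu : u = α * r ^ 2)
    (h : D * v ^ 2 = u * (u ^ 2 + a * u + b)) :
    ∃ w : ℤ, D * w ^ 2 =
      α * (α ^ 2 * r.num ^ 4 + a * α * r.num ^ 2 * (r.den : ℤ) ^ 2 + b * (r.den : ℤ) ^ 4) := by
  have hY : ((r.den : ℤ) : ℚ) ≠ 0 := by exact_mod_cast r.den_nz
  have hr' : r = (r.num : ℚ) / ((r.den : ℤ) : ℚ) := by
    conv_lhs => rw [← Rat.num_div_den r]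
    simp
  have hX : (r.num : ℚ) ≠ 0 := by exact_mod_cast Rat.num_ne_zero.mpr hr
  generalize r.num = X at *
  generalize (r.den : ℤ) = Y at *
  have h1 : (D : ℚ) * (v * Y ^ 3 / X) ^ 2 =
      ((α * (α ^ 2 * X ^ 4 + a * α * X ^ 2 * Y ^ 2 + b * Y ^ 4) : ℤ) : ℚ) := by
    rw [hu, hr'] at h
    push_cast
    field_simp at h ⊢
    linear_combination h
  obtain ⟨w, hw⟩ := int_of_sqfree hD h1
  rw [hw] at h1
  exact ⟨w, by exact_mod_cast h1⟩

theorem coprime_num_den (r : ℚ) : IsCoprime r.num (r.den : ℤ) := by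
  rw [Int.isCoprime_iff_nat_coprime]; simpa using r.reduced
theorem zmod_dvd {p : ℕ} {N : ℤ} (h : ((N : ℤ) : ZMod p) = 0) : (p : ℤ) ∣ N :=
  (ZMod.intCast_zmod_eq_zero_iff_dvd N p).mp h

theorem zmod_of_dvd {p : ℕ} {N : ℤ} (h : (p : ℤ) ∣ N) : ((N : ℤ) : ZMod p) = 0 :=
  (ZMod.intCast_zmod_eq_zero_iff_dvd N p).mpr h

theorem zmod_rep {p : ℕ} [NeZero p] (x : ZMod p) : ∃ n ∈ List.range p, ((n : ℤ) : ZMod p) = x :=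
  ⟨x.val, List.mem_range.mpr (ZMod.val_lt x), by push_cast; exact ZMod.natCast_zmod_val x⟩

/-- local condition at `p ∣ D` for the class `α` on `D v² = u (u² + a u + b)` -/
def condT (p : ℕ) (a b d1 α : ℤ) : Bool :=
  if α % p ≠ 0 then (List.range p).any fun x => (α ^ 2 * x ^ 4 + a * α * x ^ 2 + b) % p == 0
  else (List.range p).any fun x =>
    (d1 * x ^ 2 - b * (α / p)) % p == 0 || (d1 * x ^ 2 - α / p) % p == 0

theorem condT_holds (p : ℕ) [hp : Fact p.Prime] (a b d1 α m e w : ℤ) (hd1 : ¬ (p : ℤ) ∣ d1)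
    (hcop : IsCoprime m e)
    (h : (p * d1) * w ^ 2 = α * (α ^ 2 * m ^ 4 + a * α * m ^ 2 * e ^ 2 + b * e ^ 4)) :
    condT p a b d1 α = true := by
  have hpp : Prime (p : ℤ) := Nat.prime_iff_prime_int.mp hp.out
  have hp0 : (p : ℤ) ≠ 0 := hpp.ne_zero
  have hnot : (p : ℤ) ∣ e → ¬ (p : ℤ) ∣ m := fun h1 h2 => hpp.not_isUnit (hcop.isUnit_of_dvd' h2 h1)
  unfold condT
  split_ifs with hα
  · have hα' : ¬ (p : ℤ) ∣ α := fun hh => hα (Int.emod_eq_zero_of_dvd hh)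
    have h1 : (p : ℤ) ∣ α ^ 2 * m ^ 4 + a * α * m ^ 2 * e ^ 2 + b * e ^ 4 := by
      have : (p : ℤ) ∣ α * (α ^ 2 * m ^ 4 + a * α * m ^ 2 * e ^ 2 + b * e ^ 4) := by
        rw [← h]; exact ⟨d1 * w ^ 2, by ring⟩
      exact (hpp.dvd_or_dvd this).resolve_left hα'
    have he : ¬ (p : ℤ) ∣ e := by
      intro he
      obtain ⟨f, rfl⟩ := he
      have h2 : (p : ℤ) ∣ α ^ 2 * m ^ 4 := by
        have e1 : α ^ 2 * m ^ 4 = (α ^ 2 * m ^ 4 + a * α * m ^ 2 * (p * f) ^ 2 + b * (p * f) ^ 4)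
          - p * (p * f ^ 2 * (a * α * m ^ 2 + b * (p * f) ^ 2)) := by ring
        rw [e1]; exact dvd_sub h1 (dvd_mul_right _ _)
      rcases hpp.dvd_or_dvd h2 with h3 | h3
      · exact hα' (hpp.dvd_of_dvd_pow h3)
      · exact hnot (dvd_mul_right _ _) (hpp.dvd_of_dvd_pow h3)
    have he' : ((e : ℤ) : ZMod p) ≠ 0 := fun hh => he (zmod_dvd hh)
    obtain ⟨x, hx, hxe⟩ := zmod_rep ((m : ZMod p) / (e : ZMod p))
    rw [List.any_eq_true]
    refine ⟨x, hx, ?_⟩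
    simp only [beq_iff_eq]
    apply Int.emod_eq_zero_of_dvd
    apply zmod_dvd
    have h2 := zmod_of_dvd h1
    push_cast at h2 hxe ⊢
    rw [hxe]
    field_simp
    linear_combination h2
  · have hα' : (p : ℤ) ∣ α := Int.dvd_of_emod_eq_zero (not_not.mp hα)
    obtain ⟨α1, rfl⟩ := hα'
    rw [Int.mul_ediv_cancel_left _ hp0]
    have h1 : d1 * w ^ 2 =
        α1 * ((p * α1) ^ 2 * m ^ 4 + a * (p * α1) * m ^ 2 * e ^ 2 + b * e ^ 4) := by
      apply mul_left_cancel₀ hp0; linear_combination h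
    rw [List.any_eq_true]
    by_cases he : (p : ℤ) ∣ e
    · have hm := hnot he
      obtain ⟨f, rfl⟩ := he
      have hw : (p : ℤ) ∣ w := by
        have : (p : ℤ) ∣ d1 * w ^ 2 := by
          rw [h1]
          exact ⟨α1 * (p * α1 ^ 2 * m ^ 4 + a * α1 * m ^ 2 * (p * f) ^ 2 + b * p ^ 3 * f ^ 4),
            by ring⟩
        exact hpp.dvd_of_dvd_pow ((hpp.dvd_or_dvd this).resolve_left hd1)
      obtain ⟨w1, rfl⟩ := hw
      have h2 : d1 * w1 ^ 2 = α1 * (α1 ^ 2 * m ^ 4 + p * (a * α1 * m ^ 2 * f ^ 2 + b * p * f ^ 4)) := by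
        apply mul_left_cancel₀ (pow_ne_zero 2 hp0); linear_combination h1
      have hm' : ((m : ℤ) : ZMod p) ≠ 0 := fun hh => hm (zmod_dvd hh)
      have h3 := congrArg (fun t : ℤ => (t : ZMod p)) h2
      push_cast at h3
      have hpz : (p : ZMod p) = 0 := ZMod.natCast_self p
      rw [hpz] at h3
      by_cases hα1 : ((α1 : ℤ) : ZMod p) = 0
      · refine ⟨0, List.mem_range.mpr hp.out.pos, ?_⟩
        simp only [Bool.or_eq_true, beq_iff_eq]
        right
        apply Int.emod_eq_zero_of_dvd
        apply zmod_dvd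
        push_cast
        rw [hα1]; simp
      · obtain ⟨x, hx, hxe⟩ := zmod_rep ((w1 : ZMod p) / ((α1 : ZMod p) * (m : ZMod p) ^ 2))
        refine ⟨x, hx, ?_⟩
        simp only [Bool.or_eq_true, beq_iff_eq]
        right
        apply Int.emod_eq_zero_of_dvd
        apply zmod_dvd
        push_cast at hxe ⊢
        rw [hxe]
        field_simp
        linear_combination h3
    · have he' : ((e : ℤ) : ZMod p) ≠ 0 := fun hh => he (zmod_dvd hh)
      obtain ⟨x, hx, hxe⟩ := zmod_rep ((w : ZMod p) / (e : ZMod p) ^ 2)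
      refine ⟨x, hx, ?_⟩
      simp only [Bool.or_eq_true, beq_iff_eq]
      left
      apply Int.emod_eq_zero_of_dvd
      apply zmod_dvd
      have h3 := congrArg (fun t : ℤ => (t : ZMod p)) h1
      push_cast at h3 hxe ⊢
      have hpz : (p : ZMod p) = 0 := ZMod.natCast_self p
      rw [hpz] at h3
      rw [hxe]
      field_simp
      linear_combination h3

theorem sqf_d : Squarefree (318049 : ℤ) := by
  rw [← Int.squarefree_natAbs]
  have : Squarefree (318049 : ℕ) := by
    have e : (318049 : ℕ) = 47 * (67 * 101) := by norm_num
    rw [e, Nat.squarefree_mul (by norm_num), Nat.squarefree_mul (by norm_num)]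
    exact ⟨(Nat.Prime.prime (by norm_num)).squarefree, (Nat.Prime.prime (by norm_num)).squarefree,
      (Nat.Prime.prime (by norm_num)).squarefree⟩
  exact this

instance fact47 : Fact (Nat.Prime 47) := ⟨by norm_num⟩
instance fact67 : Fact (Nat.Prime 67) := ⟨by norm_num⟩
instance fact101 : Fact (Nat.Prime 101) := ⟨by norm_num⟩

theorem int_cases {c : ℤ} {l : List ℕ} (h : c.natAbs ∈ l) : ∃ n ∈ l, c = n ∨ c = -n :=
  ⟨c.natAbs, h, Int.natAbs_eq c⟩

def listOf : List ℕ → List ℕ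
  | [] => [1]
  | p :: l => listOf l ++ (listOf l).map (p * ·)

theorem listOf_mem : ∀ (l : List ℕ), (∀ p ∈ l, p.Prime) → ∀ n, n ∣ l.prod → n ∈ listOf l
  | [], _, n, hn => by simpa [listOf] using hn
  | p :: l, hl, n, hn => by
    rw [List.prod_cons] at hn
    exact dvd_list (hl p (by simp)) (listOf_mem l (fun q hq => hl q (by simp [hq]))) n hn

/-- classes on the twist of `u (u-1) (u-17)` -/
theorem E2_class {u v : ℚ} (hu : u ≠ 0) (h : 318049 * v ^ 2 = u * (u - 1) * (u - 17)) :
    ∃ r : ℚ, r ≠ 0 ∧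
      (u = r ^ 2 ∨ u = 17 * r ^ 2 ∨ u = 318049 * r ^ 2 ∨ u = 17 * 318049 * r ^ 2) := by
  have h' : ((318049 : ℤ) : ℚ) * v ^ 2 = u * (u ^ 2 + (-18 : ℤ) * u + (17 : ℤ)) := by
    push_cast; rw [h]; ring
  obtain ⟨α, hα, hq, r, hr, hur⟩ := sqclass _ _ _ hu h'
  obtain ⟨w, hw⟩ := integral_model sqf_d hr hur h'
  have hcop := coprime_num_den r
  have hpos : 0 < u := by
    rcases lt_or_gt_of_ne hu with h0 | h0
    · exfalso
      have : 0 < -u * (1 - u) * (17 - u) :=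
        mul_pos (mul_pos (by linarith) (by linarith)) (by linarith)
      nlinarith [sq_nonneg v]
    · exact h0
  have hαpos : 0 < α := by
    by_contra hneg
    have : (α : ℚ) ≤ 0 := by exact_mod_cast not_lt.mp hneg
    nlinarith [sq_nonneg r]
  have hdv : α.natAbs ∣ [17, 47, 67, 101].prod := by
    apply natAbs_dvd_of_sqfree hα
    intro q hqp hqα
    have := hq q hqp hqα
    have h2 : ([17, 47, 67, 101].prod : ℕ) = 318049 * 17 := by norm_num
    rw [h2]
    exact_mod_cast this
  have hmem := listOf_mem _ (by norm_num) _ hdv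
  have c47 := condT_holds 47 (-18) 17 6767 α _ _ w (by norm_num) hcop (by rw [← hw]; norm_num)
  have c67 := condT_holds 67 (-18) 17 4747 α _ _ w (by norm_num) hcop (by rw [← hw]; norm_num)
  obtain ⟨n, hn, hnα⟩ := int_cases hmem
  have hnα' : α = n := by omega
  subst hnα'
  have key : ∀ n ∈ listOf [17, 47, 67, 101], condT 47 (-18) 17 6767 n = true →
      condT 67 (-18) 17 4747 n = true → n = 1 ∨ n = 17 ∨ n = 318049 ∨ n = 17 * 318049 := by
    decide +kernel
  refine ⟨r, hr, ?_⟩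
  rcases key n hn c47 c67 with h1 | h1 | h1 | h1 <;> subst h1 <;> rw [hur] <;> norm_num
theorem sqf17 : Squarefree (17 : ℤ) :=
  (Int.prime_iff_natAbs_prime.mpr (by norm_num) : Prime (17 : ℤ)).squarefree

theorem sd_common {α δ C0 F0 m e w L : ℤ} (hδ : C0 ^ 2 - 17 * F0 ^ 2 = δ) (hαδ : α * δ = 318049)
    (hcop : IsCoprime m e)
    (h : δ * w ^ 2 = α ^ 2 * m ^ 4 + 9 * α * m ^ 2 * e ^ 2 + 16 * e ^ 4)
    (hL : L = C0 * (2 * α * m ^ 2 + 9 * e ^ 2) - 17 * F0 * e ^ 2 - 2 * δ * w) (hL0 : L ≠ 0) :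
    ∃ c s : ℤ, Squarefree c ∧ L = c * s ^ 2 ∧ s ≠ 0 ∧ c.natAbs ∈ listOf [2, 17, 47, 67, 101] := by
  obtain ⟨C, hC⟩ : ∃ C, C = 2 * α * m ^ 2 + 9 * e ^ 2 := ⟨_, rfl⟩
  obtain ⟨A, hA⟩ : ∃ A, A = C0 * C - 17 * F0 * e ^ 2 := ⟨_, rfl⟩
  obtain ⟨B, hB⟩ : ∃ B, B = C0 * e ^ 2 - F0 * C := ⟨_, rfl⟩
  obtain ⟨L', hL'⟩ : ∃ L', L' = A + 2 * δ * w := ⟨_, rfl⟩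
  have hLA : L = A - 2 * δ * w := by rw [hL, hA, hC]
  have h4 : 4 * δ * w ^ 2 = C ^ 2 - 17 * e ^ 4 := by rw [hC]; linear_combination 4 * h
  have hLL : L * L' = 17 * B ^ 2 := by
    rw [hLA, hL', hA, hB, ← hδ]
    rw [← hδ] at h4
    linear_combination (-(C0 ^ 2 - 17 * F0 ^ 2)) * h4
  obtain ⟨c, s, hc, hLs, hs⟩ := sqfree_part L hL0
  refine ⟨c, s, hc, hLs, hs, ?_⟩
  apply listOf_mem _ (by norm_num)
  apply natAbs_dvd_of_sqfree hc
  intro q hq hqc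
  have hprod : ([2, 17, 47, 67, 101].prod : ℕ) = 2 * 17 * 318049 := by norm_num
  rw [hprod]
  have hqp : Prime (q : ℤ) := Nat.prime_iff_prime_int.mp hq
  suffices hh : (q : ℤ) ∣ 2 * 17 * 318049 by exact_mod_cast hh
  by_cases hq17 : (q : ℤ) ∣ 17
  · exact (hq17.mul_left 2).mul_right _
  have hsq : (s : ℚ) ≠ 0 := by exact_mod_cast hs
  have hr : ((17 : ℤ) : ℚ) * ((B : ℚ) / s) ^ 2 = ((c * L' : ℤ) : ℚ) := by
    have : ((L * L' : ℤ) : ℚ) = ((17 * B ^ 2 : ℤ) : ℚ) := by rw [hLL]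
    rw [hLs] at this
    push_cast at this ⊢
    field_simp
    linear_combination -this
  obtain ⟨B', hB'⟩ := int_of_sqfree sqf17 hr
  rw [hB'] at hr
  have hr' : 17 * B' ^ 2 = c * L' := by exact_mod_cast hr
  have hBB : B = B' * s := by
    have : (B : ℚ) = B' * s := by rw [← hB']; field_simp
    exact_mod_cast this
  have hqB' : (q : ℤ) ∣ B' := by
    have : (q : ℤ) ∣ 17 * B' ^ 2 := by rw [hr']; exact hqc.mul_right _
    exact hqp.dvd_of_dvd_pow ((hqp.dvd_or_dvd this).resolve_left hq17)
  have hqB : (q : ℤ) ∣ B := by rw [hBB]; exact hqB'.mul_right _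
  have hqL : (q : ℤ) ∣ L := by rw [hLs]; exact hqc.mul_right _
  have hqL' : (q : ℤ) ∣ L' := by
    obtain ⟨c', rfl⟩ := hqc
    obtain ⟨b', rfl⟩ := hqB'
    have h1 : (q : ℤ) ∣ c' * L' := by
      refine ⟨17 * b' ^ 2, ?_⟩
      apply mul_left_cancel₀ hqp.ne_zero
      linear_combination -hr'
    rcases hqp.dvd_or_dvd h1 with h2 | h2
    · exact absurd (hc _ (mul_dvd_mul_left _ h2)) hqp.not_isUnit
    · exact h2
  have h2A : (q : ℤ) ∣ 2 * A := by
    have : 2 * A = L + L' := by rw [hLA, hL']; ring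
    rw [this]; exact dvd_add hqL hqL'
  rcases hqp.dvd_or_dvd h2A with h2 | hqA
  · exact (h2.mul_right 17).mul_right _
  have hF : (q : ℤ) ∣ δ * e ^ 2 := by
    have : δ * e ^ 2 = F0 * A + C0 * B := by rw [hA, hB, ← hδ]; ring
    rw [this]; exact dvd_add (hqA.mul_left _) (hqB.mul_left _)
  have hCd : (q : ℤ) ∣ δ * C := by
    have : δ * C = C0 * A + 17 * F0 * B := by rw [hA, hB, ← hδ]; ring
    rw [this]; exact dvd_add (hqA.mul_left _) (hqB.mul_left _)
  have hd : (q : ℤ) ∣ 2 * 318049 → (q : ℤ) ∣ 2 * 17 * 318049 := by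
    intro hh
    have : (2 * 17 * 318049 : ℤ) = 17 * (2 * 318049) := by ring
    rw [this]; exact hh.mul_left _
  apply hd
  by_cases hqδ : (q : ℤ) ∣ δ
  · rw [← hαδ]; exact (hqδ.mul_left _).mul_left _
  have hqe := hqp.dvd_of_dvd_pow ((hqp.dvd_or_dvd hF).resolve_left hqδ)
  have hqC := (hqp.dvd_or_dvd hCd).resolve_left hqδ
  have hqm : ¬ (q : ℤ) ∣ m := fun hh => hqp.not_isUnit (hcop.isUnit_of_dvd' hh hqe)
  have h2α : (q : ℤ) ∣ (2 * α) * m ^ 2 := by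
    have : (2 * α) * m ^ 2 = C - 9 * e ^ 2 := by rw [hC]; ring
    rw [this]; exact dvd_sub hqC ((dvd_pow hqe two_ne_zero).mul_left _)
  have h3 := (hqp.dvd_or_dvd h2α).resolve_right (fun hh => hqm (hqp.dvd_of_dvd_pow hh))
  rw [← hαδ, ← mul_assoc]; exact h3.mul_right _

/-- local condition for the second descent at `p ∣ α` -/
def condI (p : ℕ) (α1 δ C0 F0 c : ℤ) : Bool :=
  ((List.range p).any fun x => (δ * x ^ 2 - 16) % p == 0 &&
    (List.range p).any fun y => (c * y ^ 2 - (9 * C0 - 17 * F0 - 2 * δ * x)) % p == 0) ||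
  ((List.range p).any fun x => (δ * x ^ 2 - α1 ^ 2) % p == 0 &&
    ((2 * C0 * α1 - 2 * δ * x) % p == 0 ||
     (c % p == 0 &&
      (List.range p).any fun y => (c / p * y ^ 2 - (2 * C0 * α1 - 2 * δ * x)) % p == 0)))

theorem condI_holds (p : ℕ) [hp : Fact p.Prime] {α1 δ C0 F0 m e w L c s : ℤ}
    (hpδ : ¬ (p : ℤ) ∣ δ) (hcop : IsCoprime m e)
    (h : δ * w ^ 2 = (p * α1) ^ 2 * m ^ 4 + 9 * (p * α1) * m ^ 2 * e ^ 2 + 16 * e ^ 4)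
    (hL : L = C0 * (2 * (p * α1) * m ^ 2 + 9 * e ^ 2) - 17 * F0 * e ^ 2 - 2 * δ * w)
    (hLs : L = c * s ^ 2) : condI p α1 δ C0 F0 c = true := by
  have hpp : Prime (p : ℤ) := Nat.prime_iff_prime_int.mp hp.out
  have hp0 : (p : ℤ) ≠ 0 := hpp.ne_zero
  have hnot : (p : ℤ) ∣ e → ¬ (p : ℤ) ∣ m := fun h1 h2 => hpp.not_isUnit (hcop.isUnit_of_dvd' h2 h1)
  have hpz : (p : ZMod p) = 0 := ZMod.natCast_self p
  unfold condI
  rw [Bool.or_eq_true]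
  by_cases he : (p : ℤ) ∣ e
  · right
    have hm := hnot he
    have hm' : ((m : ℤ) : ZMod p) ≠ 0 := fun hh => hm (zmod_dvd hh)
    obtain ⟨f, rfl⟩ := he
    have hw : (p : ℤ) ∣ w := by
      have : (p : ℤ) ∣ δ * w ^ 2 := by
        rw [h]
        exact ⟨p * α1 ^ 2 * m ^ 4 + 9 * α1 * m ^ 2 * (p * f) ^ 2 + 16 * p ^ 3 * f ^ 4, by ring⟩
      exact hpp.dvd_of_dvd_pow ((hpp.dvd_or_dvd this).resolve_left hpδ)
    obtain ⟨w1, rfl⟩ := hw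
    have h2 : δ * w1 ^ 2 = α1 ^ 2 * m ^ 4 + p * (9 * α1 * m ^ 2 * f ^ 2 + 16 * p * f ^ 4) := by
      apply mul_left_cancel₀ (pow_ne_zero 2 hp0); linear_combination h
    have h3 := congrArg (fun t : ℤ => (t : ZMod p)) h2
    push_cast at h3
    rw [hpz] at h3
    have h4 : c * s ^ 2 = p * (2 * C0 * α1 * m ^ 2 - 2 * δ * w1 + p * ((9 * C0 - 17 * F0) * f ^ 2)) := by
      rw [← hLs, hL]; ring
    obtain ⟨x, hx, hxe⟩ := zmod_rep ((w1 : ZMod p) / (m : ZMod p) ^ 2)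
    push_cast at hxe
    rw [List.any_eq_true]
    refine ⟨x, hx, ?_⟩
    rw [Bool.and_eq_true]
    refine ⟨?_, ?_⟩
    · simp only [beq_iff_eq]
      apply Int.emod_eq_zero_of_dvd
      apply zmod_dvd
      push_cast
      rw [hxe]
      field_simp
      linear_combination h3
    · rw [Bool.or_eq_true]
      by_cases hpc : (p : ℤ) ∣ c
      · right
        rw [Bool.and_eq_true]
        refine ⟨by simpa using hpc, ?_⟩
        obtain ⟨c1, rfl⟩ := hpc
        rw [Int.mul_ediv_cancel_left _ hp0]
        have h5 : c1 * s ^ 2 =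
            2 * C0 * α1 * m ^ 2 - 2 * δ * w1 + p * ((9 * C0 - 17 * F0) * f ^ 2) := by
          apply mul_left_cancel₀ hp0; linear_combination h4
        have h6 := congrArg (fun t : ℤ => (t : ZMod p)) h5
        push_cast at h6
        rw [hpz] at h6
        obtain ⟨y, hy, hye⟩ := zmod_rep ((s : ZMod p) / (m : ZMod p))
        push_cast at hye
        rw [List.any_eq_true]
        refine ⟨y, hy, ?_⟩
        simp only [beq_iff_eq]
        apply Int.emod_eq_zero_of_dvd
        apply zmod_dvd
        push_cast
        rw [hxe, hye]
        field_simp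
        linear_combination h6
      · left
        have hs : (p : ℤ) ∣ s := by
          have : (p : ℤ) ∣ c * s ^ 2 := by rw [h4]; exact dvd_mul_right _ _
          exact hpp.dvd_of_dvd_pow ((hpp.dvd_or_dvd this).resolve_left hpc)
        obtain ⟨s1, rfl⟩ := hs
        have h5 : p * (c * s1 ^ 2) =
            2 * C0 * α1 * m ^ 2 - 2 * δ * w1 + p * ((9 * C0 - 17 * F0) * f ^ 2) := by
          apply mul_left_cancel₀ hp0; linear_combination h4
        have h6 := congrArg (fun t : ℤ => (t : ZMod p)) h5
        push_cast at h6
        rw [hpz] at h6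
        simp only [beq_iff_eq]
        apply Int.emod_eq_zero_of_dvd
        apply zmod_dvd
        push_cast
        rw [hxe]
        field_simp
        linear_combination -h6
  · left
    have he' : ((e : ℤ) : ZMod p) ≠ 0 := fun hh => he (zmod_dvd hh)
    have h3 := congrArg (fun t : ℤ => (t : ZMod p)) h
    have h4 := congrArg (fun t : ℤ => (t : ZMod p)) (hLs.symm.trans hL)
    push_cast at h3 h4
    rw [hpz] at h3 h4
    obtain ⟨x, hx, hxe⟩ := zmod_rep ((w : ZMod p) / (e : ZMod p) ^ 2)
    obtain ⟨y, hy, hye⟩ := zmod_rep ((s : ZMod p) / (e : ZMod p))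
    push_cast at hxe hye
    rw [List.any_eq_true]
    refine ⟨x, hx, ?_⟩
    rw [Bool.and_eq_true]
    refine ⟨?_, ?_⟩
    · simp only [beq_iff_eq]
      apply Int.emod_eq_zero_of_dvd
      apply zmod_dvd
      push_cast
      rw [hxe]
      field_simp
      linear_combination h3
    · rw [List.any_eq_true]
      refine ⟨y, hy, ?_⟩
      simp only [beq_iff_eq]
      apply Int.emod_eq_zero_of_dvd
      apply zmod_dvd
      push_cast
      rw [hxe, hye]
      field_simp
      linear_combination h4

/-- first class: `α = 6767` -/
theorem case_one {m e w : ℤ} (hcop : IsCoprime m e)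
    (h : 47 * w ^ 2 = 6767 ^ 2 * m ^ 4 + 9 * 6767 * m ^ 2 * e ^ 2 + 16 * e ^ 4) : False := by
  obtain ⟨L, hL⟩ : ∃ L, L = 8 * (2 * 6767 * m ^ 2 + 9 * e ^ 2) - 17 * 1 * e ^ 2 - 2 * 47 * w :=
    ⟨_, rfl⟩
  have hpos : 0 < 2 * 6767 * m ^ 2 + e ^ 2 := by
    by_contra hh
    have hm : m ^ 2 = 0 := by nlinarith [sq_nonneg m, sq_nonneg e]
    have he : e ^ 2 = 0 := by nlinarith [sq_nonneg m, sq_nonneg e]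
    have hm' : m = 0 := by simpa using hm
    have he' : e = 0 := by simpa using he
    subst hm' he'
    exact not_isCoprime_zero_zero hcop
  have hLL : L * (L + 4 * 47 * w) = 17 * (2 * 6767 * m ^ 2 + e ^ 2) ^ 2 := by
    rw [hL]; linear_combination (-4 * 47) * h
  have hsum : 0 < L + (L + 4 * 47 * w) := by rw [hL]; nlinarith [sq_nonneg m, sq_nonneg e]
  have hLpos : 0 < L := by
    have h1 : 0 < L * (L + 4 * 47 * w) := by rw [hLL]; positivity
    rcases mul_pos_iff.mp h1 with h2 | h2
    · exact h2.1
    · omega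
  obtain ⟨c, s, hc, hLs, hs, hmem⟩ := sd_common (α := 6767) (δ := 47) (C0 := 8) (F0 := 1)
    (by norm_num) (by norm_num) hcop h hL hLpos.ne'
  have c67 := condI_holds 67 (α1 := 101) (δ := 47) (C0 := 8) (F0 := 1) (by norm_num) hcop (by rw [h]; norm_num)
    (by rw [hL]; norm_num) hLs
  have c101 := condI_holds 101 (α1 := 67) (δ := 47) (C0 := 8) (F0 := 1) (by norm_num) hcop (by rw [h]; norm_num)
    (by rw [hL]; norm_num) hLs
  have hcpos : 0 < c := by
    rw [hLs] at hLpos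
    exact pos_of_mul_pos_left hLpos (sq_nonneg s)
  obtain ⟨n, hn, hnα⟩ := int_cases hmem
  have hnc : c = n := by omega
  subst hnc
  have key : ∀ n ∈ listOf [2, 17, 47, 67, 101], condI 67 101 47 8 1 n = true →
      condI 101 67 47 8 1 n = true → False := by
    decide +kernel
  exact key n hn c67 c101

/-- second class: `α = -47`, with odd denominator -/
theorem case_two {m e w : ℤ} (hcop : IsCoprime m e) (hodd : e % 2 = 1)
    (h : (-6767) * w ^ 2 = (-47) ^ 2 * m ^ 4 + 9 * (-47) * m ^ 2 * e ^ 2 + 16 * e ^ 4) :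
    False := by
  obtain ⟨L, hL⟩ : ∃ L, L = 55 * (2 * (-47) * m ^ 2 + 9 * e ^ 2) - 17 * 24 * e ^ 2
    - 2 * (-6767) * w := ⟨_, rfl⟩
  obtain ⟨E, rfl⟩ : ∃ E, e = 2 * E + 1 := ⟨e / 2, by omega⟩
  have hm : m % 2 = 0 := by
    rcases Int.emod_two_eq_zero_or_one m with h0 | h0
    · exact h0
    · exfalso
      obtain ⟨k, rfl⟩ : ∃ k, m = 2 * k + 1 := ⟨m / 2, by omega⟩
      have h4 := congrArg (fun t : ℤ => (t : ZMod 4)) h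
      push_cast at h4
      generalize (w : ZMod 4) = w' at h4
      generalize (k : ZMod 4) = k' at h4
      generalize (E : ZMod 4) = E' at h4
      revert w' k' E'
      decide
  obtain ⟨k, rfl⟩ : ∃ k, m = 2 * k := ⟨m / 2, by omega⟩
  have hw : w % 2 = 0 := by
    have h4 := congrArg (fun t : ℤ => (t : ZMod 2)) h
    push_cast at h4
    have : ((w : ℤ) : ZMod 2) = 0 := by
      generalize (w : ZMod 2) = w' at h4 ⊢
      generalize (k : ZMod 2) = k' at h4
      generalize (E : ZMod 2) = E' at h4
      revert w' k' E'
      decide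
    have := zmod_dvd this
    omega
  obtain ⟨W, rfl⟩ : ∃ W, w = 2 * W := ⟨w / 2, by omega⟩
  have hL4 : L % 4 = 3 := by
    have : L = 4 * (-5170 * k ^ 2 + 87 * (E ^ 2 + E) + 6767 * W + 21) + 3 := by rw [hL]; ring
    omega
  obtain ⟨c, s, hc, hLs, hs, hmem⟩ := sd_common (α := -47) (δ := -6767) (C0 := 55) (F0 := 24)
    (by norm_num) (by norm_num) hcop h hL (by omega)
  have c47 := condI_holds 47 (α1 := -1) (δ := -6767) (C0 := 55) (F0 := 24) (by norm_num) hcop (by rw [h]; norm_num)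
    (by rw [hL]; norm_num) hLs
  have hc4 : c % 4 = 3 := by
    rcases Int.emod_two_eq_zero_or_one s with h0 | h0
    · exfalso
      obtain ⟨j, rfl⟩ : ∃ j, s = 2 * j := ⟨s / 2, by omega⟩
      have : L = 4 * (c * j ^ 2) := by rw [hLs]; ring
      omega
    · obtain ⟨j, rfl⟩ : ∃ j, s = 2 * j + 1 := ⟨s / 2, by omega⟩
      have : L = 4 * (c * (j ^ 2 + j)) + c := by rw [hLs]; ring
      omega
  obtain ⟨n, hn, hnα⟩ := int_cases hmem
  have key : ∀ n ∈ listOf [2, 17, 47, 67, 101],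
      ((n : ℤ) % 4 = 3 → condI 47 (-1) (-6767) 55 24 n = true → False) ∧
      ((-n : ℤ) % 4 = 3 → condI 47 (-1) (-6767) 55 24 (-n) = true → False) := by
    decide +kernel
  rcases hnα with h1 | h1
  · subst h1; exact (key n hn).1 hc4 c47
  · subst h1; exact (key n hn).2 hc4 c47

/-- local condition for the conic `2 δ F0 E² = c (Y² - δ T²)` at `p ∣ δ` -/
def condC (p : ℕ) (δ1 F0 c : ℤ) : Bool :=
  if c % p ≠ 0 then (List.range p).any fun x => (2 * F0 * x ^ 2 + c) % p == 0
  else (List.range p).any fun x => (2 * δ1 * F0 - c / p * x ^ 2) % p == 0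

theorem condC_holds (p : ℕ) [hp : Fact p.Prime] {δ1 F0 c : ℤ}
    (h1 : ¬ (p : ℤ) ∣ δ1) (h2 : ¬ (p : ℤ) ∣ 2 * F0) (hc : Squarefree c) :
    ∀ (N : ℕ) (E Y T : ℤ), E.natAbs ≤ N → E ≠ 0 →
      2 * (p * δ1) * F0 * E ^ 2 = c * (Y ^ 2 - (p * δ1) * T ^ 2) → condC p δ1 F0 c = true := by
  have hpp : Prime (p : ℤ) := Nat.prime_iff_prime_int.mp hp.out
  have hp0 : (p : ℤ) ≠ 0 := hpp.ne_zero
  have hpz : (p : ZMod p) = 0 := ZMod.natCast_self p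
  intro N
  induction N with
  | zero => intro E Y T hE hE0; omega
  | succ N ih =>
    intro E Y T hE hE0 h
    have descend : (p : ℤ) ∣ E → (p : ℤ) ∣ Y → (p : ℤ) ∣ T → condC p δ1 F0 c = true := by
      rintro ⟨E1, rfl⟩ ⟨Y1, rfl⟩ ⟨T1, rfl⟩
      have hE1 : E1 ≠ 0 := by rintro rfl; simp at hE0
      apply ih E1 Y1 T1 _ hE1
      · apply mul_left_cancel₀ (pow_ne_zero 2 hp0); linear_combination h
      · rw [Int.natAbs_mul, Int.natAbs_natCast] at hE
        have h3 : 2 ≤ p := hp.out.two_le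
        have h4 : 0 < E1.natAbs := Int.natAbs_pos.mpr hE1
        nlinarith
    by_cases hpc : (p : ℤ) ∣ c
    · obtain ⟨c1, rfl⟩ := hpc
      have hc1 : ¬ (p : ℤ) ∣ c1 := fun hh => hpp.not_isUnit (hc _ (mul_dvd_mul_left _ hh))
      have h3 : 2 * δ1 * F0 * E ^ 2 = c1 * (Y ^ 2 - (p * δ1) * T ^ 2) := by
        apply mul_left_cancel₀ hp0; linear_combination h
      by_cases hpE : (p : ℤ) ∣ E
      · have hpY : (p : ℤ) ∣ Y := by
          have : (p : ℤ) ∣ c1 * Y ^ 2 := by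
            have e1 : c1 * Y ^ 2 = 2 * δ1 * F0 * E ^ 2 + p * (c1 * δ1 * T ^ 2) := by
              linear_combination -h3
            rw [e1]
            exact dvd_add ((dvd_pow hpE two_ne_zero).mul_left _) (dvd_mul_right _ _)
          exact hpp.dvd_of_dvd_pow ((hpp.dvd_or_dvd this).resolve_left hc1)
        have hpT : (p : ℤ) ∣ T := by
          obtain ⟨E1, rfl⟩ := hpE
          obtain ⟨Y1, rfl⟩ := hpY
          have : (p : ℤ) ∣ c1 * (δ1 * T ^ 2) := by
            refine ⟨c1 * Y1 ^ 2 - 2 * δ1 * F0 * E1 ^ 2, ?_⟩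
            apply mul_left_cancel₀ hp0; linear_combination h3
          have := (hpp.dvd_or_dvd this).resolve_left hc1
          exact hpp.dvd_of_dvd_pow ((hpp.dvd_or_dvd this).resolve_left h1)
        exact descend hpE hpY hpT
      · have hE' : ((E : ℤ) : ZMod p) ≠ 0 := fun hh => hpE (zmod_dvd hh)
        unfold condC
        rw [if_neg (by simp), List.any_eq_true, Int.mul_ediv_cancel_left _ hp0]
        obtain ⟨x, hx, hxe⟩ := zmod_rep ((Y : ZMod p) / (E : ZMod p))
        refine ⟨x, hx, ?_⟩
        simp only [beq_iff_eq]
        apply Int.emod_eq_zero_of_dvd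
        apply zmod_dvd
        have h4 := congrArg (fun t : ℤ => (t : ZMod p)) h3
        push_cast at h4 hxe ⊢
        rw [hpz] at h4
        rw [hxe]
        field_simp
        linear_combination h4
    · have hpY : (p : ℤ) ∣ Y := by
        have : (p : ℤ) ∣ c * Y ^ 2 := by
          refine ⟨2 * δ1 * F0 * E ^ 2 + c * δ1 * T ^ 2, ?_⟩
          linear_combination -h
        exact hpp.dvd_of_dvd_pow ((hpp.dvd_or_dvd this).resolve_left hpc)
      obtain ⟨Y1, hY1⟩ := hpY
      have h3 : 2 * δ1 * F0 * E ^ 2 = c * (p * Y1 ^ 2 - δ1 * T ^ 2) := by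
        apply mul_left_cancel₀ hp0; rw [hY1] at h; linear_combination h
      by_cases hpT : (p : ℤ) ∣ T
      · have hpE : (p : ℤ) ∣ E := by
          have : (p : ℤ) ∣ δ1 * (2 * F0 * E ^ 2) := by
            have e1 : δ1 * (2 * F0 * E ^ 2) = p * (c * Y1 ^ 2) - c * δ1 * T ^ 2 := by
              linear_combination h3
            rw [e1]
            exact dvd_sub (dvd_mul_right _ _) ((dvd_pow hpT two_ne_zero).mul_left _)
          have := (hpp.dvd_or_dvd this).resolve_left h1
          exact hpp.dvd_of_dvd_pow ((hpp.dvd_or_dvd this).resolve_left h2)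
        exact descend hpE ⟨Y1, hY1⟩ hpT
      · have hT' : ((T : ℤ) : ZMod p) ≠ 0 := fun hh => hpT (zmod_dvd hh)
        have hδ' : ((δ1 : ℤ) : ZMod p) ≠ 0 := fun hh => h1 (zmod_dvd hh)
        unfold condC
        rw [if_pos (by simpa using hpc), List.any_eq_true]
        obtain ⟨x, hx, hxe⟩ := zmod_rep ((E : ZMod p) / (T : ZMod p))
        refine ⟨x, hx, ?_⟩
        simp only [beq_iff_eq]
        apply Int.emod_eq_zero_of_dvd
        apply zmod_dvd
        have h4 := congrArg (fun t : ℤ => (t : ZMod p)) h3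
        push_cast at h4 hxe ⊢
        rw [hpz] at h4
        rw [hxe]
        field_simp
        apply mul_left_cancel₀ hδ'
        linear_combination h4

/-- third class: `α = -1` -/
theorem case_three {m e w : ℤ} (hcop : IsCoprime m e) (he0 : e ≠ 0)
    (h : (-318049) * w ^ 2 = (-1) ^ 2 * m ^ 4 + 9 * (-1) * m ^ 2 * e ^ 2 + 16 * e ^ 4) :
    False := by
  obtain ⟨L, hL⟩ : ∃ L, L = 32 * (2 * (-1) * m ^ 2 + 9 * e ^ 2) - 17 * 137 * e ^ 2
    - 2 * (-318049) * w := ⟨_, rfl⟩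
  obtain ⟨B, hB⟩ : ∃ B, B = 274 * m ^ 2 - 1201 * e ^ 2 := ⟨_, rfl⟩
  have hLL : L * (L - 4 * 318049 * w) = 17 * B ^ 2 := by
    rw [hL, hB]; linear_combination (4 * 318049) * h
  have hB0 : B ≠ 0 := by
    intro hB0
    have h137 : Prime (137 : ℤ) := Int.prime_iff_natAbs_prime.mpr (by norm_num)
    have h1 : 137 * (2 * m ^ 2) = 1201 * e ^ 2 := by linarith
    have h2 : (137 : ℤ) ∣ e := by
      have : (137 : ℤ) ∣ 1201 * e ^ 2 := ⟨_, h1.symm⟩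
      exact h137.dvd_of_dvd_pow ((h137.dvd_or_dvd this).resolve_left (by norm_num))
    obtain ⟨f, rfl⟩ := h2
    have h3 : (137 : ℤ) ∣ 2 * m ^ 2 := ⟨1201 * f ^ 2, by linarith⟩
    have h4 : (137 : ℤ) ∣ m :=
      h137.dvd_of_dvd_pow ((h137.dvd_or_dvd h3).resolve_left (by norm_num))
    exact h137.not_isUnit (hcop.isUnit_of_dvd' h4 (dvd_mul_right _ _))
  have hL0 : L ≠ 0 := by
    intro h0
    rw [h0, zero_mul] at hLL
    have : B ^ 2 = 0 := by linarith
    exact hB0 (by simpa using this)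
  obtain ⟨c, s, hc, hLs, hs, hmem⟩ := sd_common (α := -1) (δ := -318049) (C0 := 32) (F0 := 137)
    (by norm_num) (by norm_num) hcop h hL hL0
  have hc0 : c ≠ 0 := hc.ne_zero
  have hcon : 2 * (-318049) * 137 * (c * s * e) ^ 2
      = c * ((137 * L + 32 * B) ^ 2 - (-318049) * B ^ 2) := by
    have h1 : 2 * (-318049) * 137 * e ^ 2 * L = (137 * L + 32 * B) ^ 2 - (-318049) * B ^ 2 := by
      rw [hB, hL]; linear_combination (137 ^ 2 * 4 * 318049) * h
    rw [← h1]
    linear_combination (-(2 * (-318049) * 137 * e ^ 2 * c)) * hLs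
  have hE0 : c * s * e ≠ 0 := mul_ne_zero (mul_ne_zero hc0 hs) he0
  have c67 := condC_holds 67 (δ1 := -4747) (F0 := 137) (by norm_num) (by norm_num) hc _ _ _ _
    le_rfl hE0 (by rw [show ((67 : ℕ) : ℤ) * -4747 = -318049 by norm_num]; exact hcon)
  have c101 := condC_holds 101 (δ1 := -3149) (F0 := 137) (by norm_num) (by norm_num) hc _ _ _ _
    le_rfl hE0 (by rw [show ((101 : ℕ) : ℤ) * -3149 = -318049 by norm_num]; exact hcon)
  have hcneg : c < 0 := by
    by_contra hh
    have h1 : 0 ≤ c * ((137 * L + 32 * B) ^ 2 - (-318049) * B ^ 2) :=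
      mul_nonneg (not_lt.mp hh) (by nlinarith [sq_nonneg (137 * L + 32 * B), sq_nonneg B])
    have h2 : 0 < (c * s * e) ^ 2 := by positivity
    linarith
  obtain ⟨n, hn, hnα⟩ := int_cases hmem
  have hnc : c = -n := by omega
  subst hnc
  have key : ∀ n ∈ listOf [2, 17, 47, 67, 101], condC 67 (-4747) 137 (-n) = true →
      condC 101 (-3149) 137 (-n) = true → False := by
    decide +kernel
  exact key n hn c67 c101

theorem even_aux {A n e w : ℤ} (hA : A % 2 = 1) (he : e % 2 = 1)
    (h : 318049 * w ^ 2 = A * (8 * A ^ 2 * n ^ 4 + 9 * A * n ^ 2 * e ^ 2 + 2 * e ^ 4)) : False := by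
  obtain ⟨k, rfl⟩ : ∃ k, A = 2 * k + 1 := ⟨A / 2, by omega⟩
  obtain ⟨f, rfl⟩ : ∃ f, e = 2 * f + 1 := ⟨e / 2, by omega⟩
  have h8 := congrArg (fun t : ℤ => (t : ZMod 8)) h
  push_cast at h8
  generalize (w : ZMod 8) = w' at h8
  generalize (k : ZMod 8) = k' at h8
  generalize (n : ZMod 8) = n' at h8
  generalize (f : ZMod 8) = f' at h8
  revert w' k' n' f'
  decide +kernel

theorem even_aux2 {A m e w : ℤ} (hA : A % 2 = 1) (he : e % 2 = 1) (hm : m % 2 = 1)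
    (h : 318049 * w ^ 2 = A * (2 * A ^ 2 * m ^ 4 + 9 * A * m ^ 2 * e ^ 2 + 8 * e ^ 4)) : False := by
  obtain ⟨k, rfl⟩ : ∃ k, A = 2 * k + 1 := ⟨A / 2, by omega⟩
  obtain ⟨f, rfl⟩ : ∃ f, e = 2 * f + 1 := ⟨e / 2, by omega⟩
  obtain ⟨n, rfl⟩ : ∃ n, m = 2 * n + 1 := ⟨m / 2, by omega⟩
  have h8 := congrArg (fun t : ℤ => (t : ZMod 8)) h
  push_cast at h8
  generalize (w : ZMod 8) = w' at h8
  generalize (k : ZMod 8) = k' at h8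
  generalize (n : ZMod 8) = n' at h8
  generalize (f : ZMod 8) = f' at h8
  revert w' k' n' f'
  decide +kernel

theorem even_of_sq {w N : ℤ} (h : 318049 * w ^ 2 = 2 * N) : ∃ w', w = 2 * w' := by
  have h2 : Prime (2 : ℤ) := Int.prime_two
  have : (2 : ℤ) ∣ 318049 * w ^ 2 := ⟨N, h⟩
  exact h2.dvd_of_dvd_pow ((h2.dvd_or_dvd this).resolve_left (by norm_num))

theorem even_excl {A m e w : ℤ} (hA : A % 2 = 1) (hcop : IsCoprime m e)
    (h : 318049 * w ^ 2 = (2 * A) * ((2 * A) ^ 2 * m ^ 4 + 9 * (2 * A) * m ^ 2 * e ^ 2 + 16 * e ^ 4)) :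
    False := by
  obtain ⟨w, rfl⟩ := even_of_sq (h.trans (mul_assoc _ _ _))
  have h1 : 318049 * w ^ 2 = A * (2 * A ^ 2 * m ^ 4 + 9 * A * m ^ 2 * e ^ 2 + 8 * e ^ 4) := by
    linarith
  rcases Int.emod_two_eq_zero_or_one e with he | he
  · have hm : m % 2 = 1 := by
      rcases Int.emod_two_eq_zero_or_one m with hm | hm
      · exact absurd (hcop.isUnit_of_dvd' (Int.dvd_of_emod_eq_zero hm) (Int.dvd_of_emod_eq_zero he))
          Int.prime_two.not_isUnit
      · exact hm
    obtain ⟨f, rfl⟩ : ∃ f, e = 2 * f := ⟨e / 2, by omega⟩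
    obtain ⟨w, rfl⟩ := even_of_sq (N := A * (A ^ 2 * m ^ 4 + 18 * A * m ^ 2 * f ^ 2 + 64 * f ^ 4))
      (by rw [h1]; ring)
    have h2 : 2 * (318049 * w ^ 2) = A * (A ^ 2 * m ^ 4 + 18 * A * m ^ 2 * f ^ 2 + 64 * f ^ 4) := by
      linarith
    obtain ⟨k, rfl⟩ : ∃ k, A = 2 * k + 1 := ⟨A / 2, by omega⟩
    obtain ⟨n, rfl⟩ : ∃ n, m = 2 * n + 1 := ⟨m / 2, by omega⟩
    have h8 := congrArg (fun t : ℤ => (t : ZMod 2)) h2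
    push_cast at h8
    generalize (w : ZMod 2) = w' at h8
    generalize (k : ZMod 2) = k' at h8
    generalize (n : ZMod 2) = n' at h8
    generalize (f : ZMod 2) = f' at h8
    revert w' k' n' f'
    decide +kernel
  · rcases Int.emod_two_eq_zero_or_one m with hm | hm
    · obtain ⟨n, rfl⟩ : ∃ n, m = 2 * n := ⟨m / 2, by omega⟩
      obtain ⟨w, rfl⟩ := even_of_sq
        (N := 2 * (A * (8 * A ^ 2 * n ^ 4 + 9 * A * n ^ 2 * e ^ 2 + 2 * e ^ 4)))
        (by rw [h1]; ring)
      exact even_aux hA he (n := n) (w := w) (by linarith)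
    · exact even_aux2 hA he hm h1

/-- classes on `E4` -/
theorem E4_class {u v : ℚ} (hu : u ≠ 0) (h : 318049 * v ^ 2 = u * (u ^ 2 + 9 * u + 16)) :
    ∃ r : ℚ, r ≠ 0 ∧ u = 318049 * r ^ 2 := by
  have h' : ((318049 : ℤ) : ℚ) * v ^ 2 = u * (u ^ 2 + (9 : ℤ) * u + (16 : ℤ)) := by
    push_cast; rw [h]
  obtain ⟨α, hα, hq, r, hr, hur⟩ := sqclass _ _ _ hu h'
  obtain ⟨w, hw⟩ := integral_model sqf_d hr hur h'
  have hcop := coprime_num_den r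
  have hdv : α.natAbs ∣ [2, 47, 67, 101].prod := by
    apply natAbs_dvd_of_sqfree hα
    intro q hqp hqα
    have h1 : (q : ℤ) ∣ 318049 * 16 := hq q hqp hqα
    have hqp' : Prime (q : ℤ) := Nat.prime_iff_prime_int.mp hqp
    have h2 : ([2, 47, 67, 101].prod : ℕ) = 318049 * 2 := by norm_num
    rw [h2]
    suffices hh : (q : ℤ) ∣ 318049 * 2 by exact_mod_cast hh
    rcases hqp'.dvd_or_dvd h1 with h3 | h3
    · exact h3.mul_right _
    · have h4 : (q : ℤ) ∣ 2 ^ 4 := by norm_num; exact h3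
      exact (hqp'.dvd_of_dvd_pow h4).mul_left _
  have hmem := listOf_mem _ (by norm_num) _ hdv
  have c47 := condT_holds 47 9 16 6767 α _ _ w (by norm_num) hcop (by rw [← hw]; norm_num)
  have c67 := condT_holds 67 9 16 4747 α _ _ w (by norm_num) hcop (by rw [← hw]; norm_num)
  have c101 := condT_holds 101 9 16 3149 α _ _ w (by norm_num) hcop (by rw [← hw]; norm_num)
  have hodd : α % 2 = 1 := by
    rcases Int.emod_two_eq_zero_or_one α with h0 | h0
    · exfalso
      obtain ⟨A, rfl⟩ : ∃ A, α = 2 * A := ⟨α / 2, by omega⟩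
      refine even_excl (A := A) ?_ hcop hw
      rcases Int.emod_two_eq_zero_or_one A with h1 | h1
      · exact absurd (hα 2 (mul_dvd_mul_left _ (Int.dvd_of_emod_eq_zero h1)))
          Int.prime_two.not_isUnit
      · exact h1
    · exact h0
  obtain ⟨n, hn, hnα⟩ := int_cases hmem
  have key1 : ∀ n ∈ listOf [2, 47, 67, 101], (n : ℤ) % 2 = 1 → condT 47 9 16 6767 n = true →
        condT 67 9 16 4747 n = true → condT 101 9 16 3149 n = true → n = 6767 ∨ n = 318049 := by
    decide +kernel
  have key2 : ∀ n ∈ listOf [2, 47, 67, 101], (-n : ℤ) % 2 = 1 → condT 47 9 16 6767 (-n) = true →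
        condT 67 9 16 4747 (-n) = true → condT 101 9 16 3149 (-n) = true → n = 1 ∨ n = 47 := by
    decide +kernel
  have hden : ((r.den : ℤ)) ≠ 0 := by exact_mod_cast r.den_nz
  rcases hnα with h1 | h1
  · subst h1
    rcases key1 n hn hodd c47 c67 c101 with h2 | h2
    · exfalso
      subst h2
      push_cast at hw
      exact case_one hcop (w := w) (by linarith)
    · subst h2
      exact ⟨r, hr, by rw [hur]; norm_num⟩
  · exfalso
    subst h1
    rcases key2 n hn hodd c47 c67 c101 with h2 | h2
    · subst h2
      push_cast at hw
      exact case_three hcop hden (w := w) (by linarith)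
    · subst h2
      have main : ∀ {u v r : ℚ}, r ≠ 0 → u = ((-47 : ℤ) : ℚ) * r ^ 2 →
          ((318049 : ℤ) : ℚ) * v ^ 2 = u * (u ^ 2 + (9 : ℤ) * u + (16 : ℤ)) →
          ((r.den : ℤ)) % 2 = 1 → False := by
        intro u v r hr hur h' hd
        obtain ⟨w, hw⟩ := integral_model sqf_d hr hur h'
        exact case_two (coprime_num_den r) hd (w := w) (by linarith)
      have hur' : u = ((-47 : ℤ) : ℚ) * r ^ 2 := by rw [hur]; norm_num
      rcases Int.emod_two_eq_zero_or_one (r.den : ℤ) with hd | hd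
      · have hm : r.num % 2 = 1 := by
          rcases Int.emod_two_eq_zero_or_one r.num with hm | hm
          · exact absurd (hcop.isUnit_of_dvd' (Int.dvd_of_emod_eq_zero hm)
              (Int.dvd_of_emod_eq_zero hd)) Int.prime_two.not_isUnit
          · exact hm
        have e1 : (-4 / (47 * r) : ℚ) = Rat.divInt (-4 * (r.den : ℤ)) (47 * r.num) := by
          have hnum : (r.num : ℚ) ≠ 0 := by exact_mod_cast Rat.num_ne_zero.mpr hr
          have hdq : (r.den : ℚ) ≠ 0 := by exact_mod_cast hden
          rw [Rat.divInt_eq_div]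
          push_cast
          have h3 : r = (r.num : ℚ) / (r.den : ℚ) := (Rat.num_div_den r).symm
          generalize (r.num : ℚ) = X at *
          generalize (r.den : ℚ) = Y at *
          subst h3
          field_simp
        have h5 := Rat.den_dvd (-4 * (r.den : ℤ)) (47 * r.num)
        rw [← e1] at h5
        refine main (u := 16 / u) (v := 16 * v / u ^ 2) (r := -4 / (47 * r)) ?_ ?_ ?_ ?_
        · exact div_ne_zero (by norm_num) (mul_ne_zero (by norm_num) hr)
        · rw [hur']; push_cast; field_simp; norm_num
        · push_cast
          field_simp
          linear_combination h
        · rcases Int.emod_two_eq_zero_or_one ((-4 / (47 * r) : ℚ).den : ℤ) with h6 | h6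
          · exfalso
            have h7 : (2 : ℤ) ∣ 47 * r.num := (Int.dvd_of_emod_eq_zero h6).trans h5
            omega
          · exact h6
      · exact main hr hur' h' hd

theorem val_ge {k : ℕ} {n : ℤ} (hn : n ≠ 0) (h : (2 : ℤ) ^ k ∣ n) :
    (k : ℤ) ≤ padicValRat 2 (n : ℚ) := by
  rw [padicValRat.of_int]
  have h2 : ((2 : ℕ) : ℤ) ^ k ∣ n := by exact_mod_cast h
  have := ((padicValInt_dvd_iff k n).mp h2).resolve_left hn
  exact_mod_cast this

theorem val_odd {n : ℤ} (h : n % 2 = 1) : padicValRat 2 (n : ℚ) = 0 := by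
  rw [padicValRat.of_int]
  have : padicValInt 2 n = 0 := by
    apply padicValInt.eq_zero_of_not_dvd
    push_cast
    omega
  rw [this]; rfl

theorem odd_rep {x : ℚ} (hx : x ≠ 0) (h : padicValRat 2 x = 0) :
    ∃ a b : ℤ, a % 2 = 1 ∧ b % 2 = 1 ∧ x = a / b := by
  have hcop := coprime_num_den x
  have hn0 : x.num ≠ 0 := Rat.num_ne_zero.mpr hx
  have hd0 : (x.den : ℤ) ≠ 0 := by exact_mod_cast x.den_nz
  have hxe : x = (x.num : ℚ) / ((x.den : ℤ) : ℚ) := by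
    conv_lhs => rw [← Rat.num_div_den x]
    simp
  refine ⟨x.num, x.den, ?_, ?_, hxe⟩
  all_goals
    generalize x.num = X at *
    generalize (x.den : ℤ) = Y at *
    have hv : padicValRat 2 x = padicValRat 2 (X : ℚ) - padicValRat 2 (Y : ℚ) := by
      rw [hxe, padicValRat.div (by exact_mod_cast hn0) (by exact_mod_cast hd0)]
    have hnot : ¬ (X % 2 = 0 ∧ Y % 2 = 0) := fun ⟨h1, h2⟩ =>
      Int.prime_two.not_isUnit (hcop.isUnit_of_dvd' (Int.dvd_of_emod_eq_zero h1)
        (Int.dvd_of_emod_eq_zero h2))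
    by_contra hh
    rcases Int.emod_two_eq_zero_or_one X with h1 | h1
    · have h2 : Y % 2 = 1 := by omega
      have := val_ge (k := 1) hn0 (by simpa using Int.dvd_of_emod_eq_zero h1)
      rw [val_odd h2] at hv
      push_cast at this
      omega
    · have h2 : Y % 2 = 0 := by omega
      have := val_ge (k := 1) hd0 (by simpa using Int.dvd_of_emod_eq_zero h2)
      rw [val_odd h1] at hv
      push_cast at this
      omega

theorem val_two_pow (k : ℕ) : padicValRat 2 ((2 : ℚ) ^ k) = k := by
  have h : padicValRat 2 (2 : ℚ) = 1 := by
    have := padicValRat.self (p := 2) (by norm_num)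
    exact_mod_cast this
  rw [padicValRat.pow, h]; ring

theorem val_sq {x : ℚ} (hx : x ≠ 0) : padicValRat 2 (x ^ 2) = 2 * padicValRat 2 x := by
  rw [padicValRat.pow]; norm_num

theorem val_quad {x : ℚ} (hx : x ≠ 0) (hv : padicValRat 2 x = 0) (hB : x ^ 2 + 9 * x + 16 ≠ 0) :
    1 ≤ padicValRat 2 (x ^ 2 + 9 * x + 16) := by
  obtain ⟨a, b, ha, hb, rfl⟩ := odd_rep hx hv
  have hb0 : (b : ℚ) ≠ 0 := by
    intro h; have : b = 0 := by exact_mod_cast h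
    omega
  have e : ((a : ℚ) / b) ^ 2 + 9 * (a / b) + 16 = ((a ^ 2 + 9 * (a * b) + 16 * b ^ 2 : ℤ) : ℚ) / b ^ 2 := by
    push_cast; field_simp
  have hn : (a ^ 2 + 9 * (a * b) + 16 * b ^ 2 : ℤ) ≠ 0 := by
    intro h; rw [e, h] at hB; simp at hB
  rw [e, padicValRat.div (by exact_mod_cast hn) (pow_ne_zero _ hb0), val_sq hb0, val_odd hb]
  have := val_ge (k := 1) hn (by
    obtain ⟨k, rfl⟩ : ∃ k, a = 2 * k + 1 := ⟨a / 2, by omega⟩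
    obtain ⟨l, rfl⟩ : ∃ l, b = 2 * l + 1 := ⟨b / 2, by omega⟩
    exact ⟨2 * k ^ 2 + 2 * k + 18 * k * l + 9 * k + 9 * l + 32 * l ^ 2 + 32 * l + 13, by ring⟩)
  push_cast at this ⊢
  linarith

theorem val_sq_sub {x : ℚ} (hx : x ≠ 0) (hv : padicValRat 2 x = 0) (hB : x ^ 2 - 1 ≠ 0) :
    3 ≤ padicValRat 2 (x ^ 2 - 1) := by
  obtain ⟨a, b, ha, hb, rfl⟩ := odd_rep hx hv
  have hb0 : (b : ℚ) ≠ 0 := by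
    intro h; have : b = 0 := by exact_mod_cast h
    omega
  have e : ((a : ℚ) / b) ^ 2 - 1 = ((a ^ 2 - b ^ 2 : ℤ) : ℚ) / b ^ 2 := by
    push_cast; field_simp
  have hn : (a ^ 2 - b ^ 2 : ℤ) ≠ 0 := by
    intro h; rw [e, h] at hB; simp at hB
  rw [e, padicValRat.div (by exact_mod_cast hn) (pow_ne_zero _ hb0), val_sq hb0, val_odd hb]
  have := val_ge (k := 3) hn (by
    have h1 : ∀ {n : ℤ}, n % 2 = 1 → n ^ 2 % 8 = 1 := by
      intro n hn
      have : n % 8 = 1 ∨ n % 8 = 3 ∨ n % 8 = 5 ∨ n % 8 = 7 := by omega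
      rcases this with h | h | h | h <;> rw [pow_two, Int.mul_emod, h] <;> rfl
    have h2 := h1 ha
    have h3 := h1 hb
    norm_num
    omega)
  push_cast at this ⊢
  linarith

theorem val_add {x y : ℚ} (hx : x ≠ 0) (h : y = 0 ∨ padicValRat 2 x < padicValRat 2 y) :
    x + y ≠ 0 ∧ padicValRat 2 (x + y) = padicValRat 2 x := by
  rcases h with h | h
  · subst h; simpa using hx
  · by_cases hy : y = 0
    · subst hy; simpa using hx
    have hxy : x + y ≠ 0 := by
      intro h0
      have : y = -x := by linarith
      rw [this, padicValRat.neg] at h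
      exact lt_irrefl _ h
    exact ⟨hxy, padicValRat.add_eq_of_lt hxy hx hy h⟩

/-- the 2-adic analysis of the doubling formula on `E4` -/
theorem dbl_val {t T : ℚ} (ht : t ≠ 0) (hT : T ≠ 0) (heven : Even (padicValRat 2 t))
    (h : 4 * t * (t ^ 2 + 9 * t + 16) * T = (t ^ 2 - 16) ^ 2) :
    (padicValRat 2 t < 0 → padicValRat 2 T = padicValRat 2 t - 2) ∧
    (4 < padicValRat 2 t → padicValRat 2 T = 2 - padicValRat 2 t) ∧
    (0 ≤ padicValRat 2 t → padicValRat 2 t ≤ 4 → padicValRat 2 T < 0 ∨ 4 < padicValRat 2 T) := by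
  have hB : t ^ 2 + 9 * t + 16 ≠ 0 := by
    intro h0
    rw [h0] at h
    have h1 : t ^ 2 - 16 = 0 := by
      have : (t ^ 2 - 16) ^ 2 = 0 := by rw [← h]; ring
      simpa using this
    have h2 : t = -32 / 9 := by linarith
    rw [h2] at h1; norm_num at h1
  have hC : t ^ 2 - 16 ≠ 0 := by
    intro h0
    rw [h0] at h
    have : 4 * t * (t ^ 2 + 9 * t + 16) * T ≠ 0 :=
      mul_ne_zero (mul_ne_zero (mul_ne_zero (by norm_num) ht) hB) hT
    apply this; rw [h]; norm_num
  have v4 : padicValRat 2 (4 : ℚ) = 2 := by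
    have := val_two_pow 2; norm_num at this; exact this
  have v16 : padicValRat 2 (16 : ℚ) = 4 := by
    have := val_two_pow 4; norm_num at this; exact this
  have vm16 : padicValRat 2 (-16 : ℚ) = 4 := by rw [padicValRat.neg]; exact v16
  have v9 : padicValRat 2 (9 : ℚ) = 0 := by
    have := val_odd (n := 9) (by norm_num); norm_num at this; exact_mod_cast this
  have v9t : padicValRat 2 (9 * t) = padicValRat 2 t := by
    rw [padicValRat.mul (by norm_num) ht, v9]; ring
  have key : 2 + padicValRat 2 t + padicValRat 2 (t ^ 2 + 9 * t + 16) + padicValRat 2 T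
      = 2 * padicValRat 2 (t ^ 2 - 16) := by
    rw [← val_sq hC, ← h, padicValRat.mul (mul_ne_zero (mul_ne_zero (by norm_num) ht) hB) hT,
      padicValRat.mul (mul_ne_zero (by norm_num) ht) hB, padicValRat.mul (by norm_num) ht, v4]
  have ht2 : t ^ 2 ≠ 0 := pow_ne_zero _ ht
  have vt2 := val_sq ht
  refine ⟨?_, ?_, ?_⟩
  · intro hneg
    have h1 := val_add (x := t ^ 2) (y := 9 * t) ht2 (Or.inr (by rw [vt2, v9t]; linarith))
    have h2 := val_add (x := t ^ 2 + 9 * t) (y := 16) h1.1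
      (Or.inr (by rw [h1.2, vt2, v16]; linarith))
    have h3 := val_add (x := t ^ 2) (y := -16) ht2 (Or.inr (by rw [vt2, vm16]; linarith))
    rw [← sub_eq_add_neg] at h3
    rw [h2.2, h1.2, h3.2, vt2] at key
    linarith
  · intro hpos
    have h1 := val_add (x := 16) (y := 9 * t) (by norm_num) (Or.inr (by rw [v9t, v16]; linarith))
    have h2 := val_add (x := 16 + 9 * t) (y := t ^ 2) h1.1
      (Or.inr (by rw [h1.2, vt2, v16]; linarith))
    have h3 := val_add (x := -16) (y := t ^ 2) (by norm_num) (Or.inr (by rw [vt2, vm16]; linarith))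
    rw [show (16 + 9 * t + t ^ 2 : ℚ) = t ^ 2 + 9 * t + 16 by ring] at h2
    rw [show (-16 + t ^ 2 : ℚ) = t ^ 2 - 16 by ring] at h3
    rw [h2.2, h1.2, h3.2, v16, vm16] at key
    linarith
  · intro hge hle
    have hcases : padicValRat 2 t = 0 ∨ padicValRat 2 t = 2 ∨ padicValRat 2 t = 4 := by
      obtain ⟨k, hk⟩ := heven
      omega
    rcases hcases with h0 | h0 | h0
    · left
      have h1 := val_quad ht h0 hB
      have h3 := val_add (x := t ^ 2) (y := -16) ht2 (Or.inr (by rw [vt2, vm16, h0]; norm_num))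
      rw [← sub_eq_add_neg] at h3
      rw [h3.2, vt2, h0] at key
      linarith
    · right
      obtain ⟨s, hs⟩ : ∃ s, t = 4 * s := ⟨t / 4, by ring⟩
      have hs0 : s ≠ 0 := by rintro rfl; apply ht; rw [hs]; ring
      have vs : padicValRat 2 s = 0 := by
        rw [hs, padicValRat.mul (by norm_num) hs0, v4] at h0; linarith
      have e1 : t ^ 2 - 16 = 16 * (s ^ 2 - 1) := by rw [hs]; ring
      have hs1 : s ^ 2 - 1 ≠ 0 := by intro h1; apply hC; rw [e1, h1]; ring
      have h1 := val_sq_sub hs0 vs hs1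
      have h2 := val_add (x := 9 * t) (y := t ^ 2 + 16) (mul_ne_zero (by norm_num) ht) (by
        by_cases h5 : t ^ 2 + 16 = 0
        · exact Or.inl h5
        · right
          have := padicValRat.min_le_padicValRat_add (p := 2) h5
          rw [vt2, v16, h0] at this
          rw [v9t, h0]
          norm_num at this
          linarith)
      rw [show (9 * t + (t ^ 2 + 16) : ℚ) = t ^ 2 + 9 * t + 16 by ring] at h2
      rw [h2.2, v9t, h0, e1, padicValRat.mul (by norm_num) hs1, v16] at key
      linarith
    · left
      obtain ⟨s, hs⟩ : ∃ s, t = 16 / s := ⟨16 / t, by field_simp⟩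
      have hs0 : s ≠ 0 := by rintro rfl; apply ht; rw [hs]; simp
      have vs : padicValRat 2 s = 0 := by
        rw [hs, padicValRat.div (by norm_num) hs0, v16] at h0; linarith
      have e1 : t ^ 2 + 9 * t + 16 = 16 * (s ^ 2 + 9 * s + 16) / s ^ 2 := by
        rw [hs]; field_simp
        ring
      have hq0 : s ^ 2 + 9 * s + 16 ≠ 0 := by intro h1; apply hB; rw [e1, h1]; simp
      have h1 := val_quad hs0 vs hq0
      have h3 := val_add (x := -16) (y := t ^ 2) (by norm_num)
        (Or.inr (by rw [vt2, vm16, h0]; norm_num))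
      rw [show (-16 + t ^ 2 : ℚ) = t ^ 2 - 16 by ring] at h3
      rw [h3.2, vm16, e1, padicValRat.div (mul_ne_zero (by norm_num) hq0) (pow_ne_zero _ hs0),
        padicValRat.mul (by norm_num) hq0, v16, val_sq hs0, vs, h0] at key
      linarith

theorem E4_up {u v s : ℚ} (hu0 : u ≠ 0) (hu : u = 318049 * s ^ 2)
    (h : 318049 * v ^ 2 = u * (u - 1) * (u - 17)) :
    ∃ t w : ℚ, t ≠ 0 ∧ 318049 * w ^ 2 = t * (t ^ 2 + 9 * t + 16) ∧
      ∀ T, 4 * u * T = (u - 1) * (u - 17) → 4 * t * (t ^ 2 + 9 * t + 16) * T = (t ^ 2 - 16) ^ 2 := by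
  have hs : s ≠ 0 := by rintro rfl; apply hu0; rw [hu]; ring
  obtain ⟨y, hy⟩ : ∃ y, y = v / s := ⟨_, rfl⟩
  have hv : v = y * s := by rw [hy]; field_simp
  have hy2 : y ^ 2 = (u - 1) * (u - 17) := by
    have hs2 : (318049 * s ^ 2 : ℚ) ≠ 0 := by rw [← hu]; exact hu0
    apply mul_left_cancel₀ hs2
    rw [hv] at h
    rw [← hu]
    linear_combination h + y ^ 2 * hu
  obtain ⟨t, ht⟩ : ∃ t, t = (u - 9 + y) / 2 := ⟨_, rfl⟩
  have hq : t ^ 2 + 9 * t + 16 = u * t := by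
    rw [ht]; linear_combination hy2 / 4
  have ht0 : t ≠ 0 := by rintro rfl; norm_num at hq
  refine ⟨t, t * s, ht0, ?_, ?_⟩
  · rw [hq]; linear_combination -t ^ 2 * hu
  · intro T hT
    have e : t ^ 2 = (u - 9) * t - 16 := by linear_combination hq
    rw [hq]
    linear_combination t ^ 2 * hT - (t ^ 2 + 9 * t + 16 + u * t - 18 * t) * hq

theorem E4_half_a {u v t s : ℚ} (hu0 : u ≠ 0) (hu : u = s ^ 2 ∨ u = 318049 * s ^ 2)
    (h : 318049 * v ^ 2 = u * (u - 1) * (u - 17)) (ht : t ≠ 0)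
    (hut : 4 * u * t = (u - 1) * (u - 17)) :
    ∃ t' w' T : ℚ, t' ≠ 0 ∧ 318049 * w' ^ 2 = t' * (t' ^ 2 + 9 * t' + 16) ∧
      (T = t ∨ T = 16 / t) ∧
      4 * t' * (t' ^ 2 + 9 * t' + 16) * T = (t' ^ 2 - 16) ^ 2 := by
  rcases hu with hu | hu
  · have hne : 4 * u * t ≠ 0 := mul_ne_zero (mul_ne_zero (by norm_num) hu0) ht
    rw [hut] at hne
    have h1 : u - 1 ≠ 0 := left_ne_zero_of_mul hne
    have h17 : u - 17 ≠ 0 := right_ne_zero_of_mul hne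
    have hs : s ≠ 0 := by rintro rfl; apply hu0; rw [hu]; ring
    obtain ⟨t', w', h2, h3, h4⟩ := E4_up (u := (u - 17) / (u - 1)) (v := 16 * v / (u - 1) ^ 2)
      (s := v / (s * (u - 1))) (div_ne_zero h17 h1)
      (by
        rw [div_pow, mul_pow, ← hu]
        field_simp
        linear_combination -h)
      (by
        field_simp
        linear_combination 256 * h)
    refine ⟨t', w', 16 / t, h2, h3, Or.inr rfl, h4 _ ?_⟩
    have h5 : t = (u - 1) * (u - 17) / (4 * u) := by field_simp; linear_combination hut
    rw [h5]
    field_simp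
    ring
  · obtain ⟨t', w', h2, h3, h4⟩ := E4_up hu0 hu h
    exact ⟨t', w', t, h2, h3, Or.inl rfl, h4 _ hut⟩

theorem E4_half {t w : ℚ} (ht : t ≠ 0) (h : 318049 * w ^ 2 = t * (t ^ 2 + 9 * t + 16)) :
    ∃ t' w' T : ℚ, t' ≠ 0 ∧ 318049 * w' ^ 2 = t' * (t' ^ 2 + 9 * t' + 16) ∧
      (T = t ∨ T = 16 / t) ∧
      4 * t' * (t' ^ 2 + 9 * t' + 16) * T = (t' ^ 2 - 16) ^ 2 := by
  obtain ⟨r, hr, htr⟩ := E4_class ht h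
  obtain ⟨y, hy⟩ : ∃ y, y = w / r := ⟨_, rfl⟩
  have hw : w = y * r := by rw [hy]; field_simp
  have hy2 : y ^ 2 = t ^ 2 + 9 * t + 16 := by
    apply mul_left_cancel₀ ht
    rw [← h, hw]; linear_combination y ^ 2 * htr
  obtain ⟨u, hu⟩ : ∃ u, u = 9 + 2 * t + 2 * y := ⟨_, rfl⟩
  have hut : 4 * u * t = (u - 1) * (u - 17) := by rw [hu]; linear_combination -4 * hy2
  have hu0 : u ≠ 0 := by rintro h0; rw [h0] at hut; norm_num at hut
  have h2 : 318049 * (2 * u * r) ^ 2 = u * (u - 1) * (u - 17) := by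
    linear_combination u * hut - 4 * u ^ 2 * htr
  obtain ⟨s, hs, hcl⟩ := E2_class hu0 h2
  rcases hcl with h3 | h3 | h3 | h3
  · exact E4_half_a hu0 (Or.inl h3) h2 ht hut
  · refine E4_half_a (u := 17 / u) (v := 17 * (2 * u * r) / u ^ 2) (s := 1 / s)
      (div_ne_zero (by norm_num) hu0) (Or.inl ?_) ?_ ht ?_
    · rw [h3]; field_simp
    · field_simp at h2 ⊢; linear_combination h2
    · field_simp; linear_combination hut
  · exact E4_half_a hu0 (Or.inr h3) h2 ht hut
  · refine E4_half_a (u := 17 / u) (v := 17 * (2 * u * r) / u ^ 2) (s := 1 / (318049 * s))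
      (div_ne_zero (by norm_num) hu0) (Or.inr ?_) ?_ ht ?_
    · rw [h3]; field_simp
    · field_simp at h2 ⊢; linear_combination h2
    · field_simp; linear_combination hut

theorem E4_even {t w : ℚ} (ht : t ≠ 0) (h : 318049 * w ^ 2 = t * (t ^ 2 + 9 * t + 16)) :
    Even (padicValRat 2 t) := by
  obtain ⟨r, hr, htr⟩ := E4_class ht h
  have hd : padicValRat 2 (318049 : ℚ) = 0 := by
    have := val_odd (n := 318049) (by norm_num); rwa [Int.cast_ofNat] at this
  rw [htr, padicValRat.mul (by norm_num) (pow_ne_zero _ hr), val_sq hr, hd]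
  exact ⟨padicValRat 2 r, by ring⟩

theorem E4_val_T {t T : ℚ} (ht : t ≠ 0) (hT : T = t ∨ T = 16 / t) :
    T ≠ 0 ∧ (padicValRat 2 T = padicValRat 2 t ∨ padicValRat 2 T = 4 - padicValRat 2 t) := by
  have v16 : padicValRat 2 (16 : ℚ) = 4 := by
    have := val_two_pow 4; norm_num at this; exact this
  rcases hT with rfl | rfl
  · exact ⟨ht, Or.inl rfl⟩
  · exact ⟨div_ne_zero (by norm_num) ht, Or.inr (by rw [padicValRat.div (by norm_num) ht, v16])⟩

theorem E4_good {t w : ℚ} (ht : t ≠ 0) (h : 318049 * w ^ 2 = t * (t ^ 2 + 9 * t + 16)) :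
    padicValRat 2 t < 0 ∨ 4 < padicValRat 2 t := by
  obtain ⟨t', w', T, ht', h', hT, hd⟩ := E4_half ht h
  obtain ⟨hT0, hTv⟩ := E4_val_T ht hT
  obtain ⟨h1, h2, h3⟩ := dbl_val ht' hT0 (E4_even ht' h') hd
  by_cases c1 : padicValRat 2 t' < 0
  · have := h1 c1; omega
  · by_cases c2 : 4 < padicValRat 2 t'
    · have := h2 c2; omega
    · have := h3 (not_lt.mp c1) (not_lt.mp c2); omega

theorem E4_none : ∀ (N : ℕ) (t w : ℚ), t ≠ 0 → 318049 * w ^ 2 = t * (t ^ 2 + 9 * t + 16) →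
    |padicValRat 2 t - 2| ≤ N → False := by
  intro N
  induction N with
  | zero =>
    intro t w ht h hN
    have := E4_good ht h
    have h2 := abs_le.mp hN
    push_cast at h2
    omega
  | succ N ih =>
    intro t w ht h hN
    obtain ⟨t', w', T, ht', h', hT, hd⟩ := E4_half ht h
    obtain ⟨hT0, hTv⟩ := E4_val_T ht hT
    obtain ⟨h1, h2, h3⟩ := dbl_val ht' hT0 (E4_even ht' h') hd
    apply ih t' w' ht' h'
    have h4 := abs_le.mp hN
    rw [abs_le]
    push_cast at h4
    rcases E4_good ht' h' with c | c
    · have := h1 c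
      omega
    · have := h2 c
      omega

/-- the twist by `318049` has only the trivial rational point -/
theorem twist_none {U V : ℚ} (h : 318049 * V ^ 2 = U * (U ^ 2 + 30 * U + 289)) : U = 0 := by
  by_contra hU
  have hq : U ^ 2 + 30 * U + 289 ≠ 0 := by nlinarith [sq_nonneg (U + 15)]
  obtain ⟨u, hu⟩ : ∃ u, u = (U ^ 2 + 30 * U + 289) / U / 4 + 1 := ⟨_, rfl⟩
  obtain ⟨v, hv⟩ : ∃ v, v = V * (U ^ 2 - 289) / U ^ 2 / 8 := ⟨_, rfl⟩
  have h2 : 318049 * v ^ 2 = u * (u - 1) * (u - 17) := by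
    rw [hu, hv]; field_simp; linear_combination 64 * (U ^ 2 - 289) ^ 2 * h
  have hu1 : u - 1 ≠ 0 := by
    rw [hu, add_sub_cancel_right]
    exact div_ne_zero (div_ne_zero hq hU) (by norm_num)
  have hu0 : u ≠ 0 := by
    intro h0
    have : (U + 17) ^ 2 = 0 := by
      rw [hu] at h0; field_simp at h0; linear_combination h0
    have h3 : U = -17 := by
      have : U + 17 = 0 := by simpa using this
      linarith
    rw [h3] at h
    nlinarith [sq_nonneg V]
  have hu17 : u - 17 ≠ 0 := by
    intro h0
    have : (U - 17) ^ 2 = 0 := by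
      rw [hu] at h0; field_simp at h0; linear_combination h0
    have h3 : U = 17 := by
      have : U - 17 = 0 := by simpa using this
      linarith
    rw [h3] at h
    have h4 : ((318049 : ℤ) : ℚ) * (V / 136) ^ 2 = (1 : ℤ) := by push_cast; linarith
    obtain ⟨k, hk⟩ := int_of_sqfree sqf_d h4
    rw [hk] at h4
    have h5 : (318049 : ℤ) * k ^ 2 = 1 := by exact_mod_cast h4
    omega
  refine E4_none _ ((u - 1) * (u - 17) / (4 * u)) (v * (u ^ 2 - 17) / (8 * u ^ 2)) ?_ ?_
    (Int.abs_eq_natAbs _).le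
  · exact div_ne_zero (mul_ne_zero hu1 hu17) (mul_ne_zero (by norm_num) hu0)
  · field_simp
    linear_combination 64 * (u ^ 2 - 17) ^ 2 * h2

theorem E3_class {t w : ℚ} (ht : t ≠ 0) (h : w ^ 2 = t * (t ^ 2 - 66 * t + 1)) :
    ∃ r : ℚ, r ≠ 0 ∧ t = r ^ 2 := by
  have h' : ((1 : ℤ) : ℚ) * w ^ 2 = t * (t ^ 2 + (-66 : ℤ) * t + (1 : ℤ)) := by
    push_cast; rw [h]; ring
  obtain ⟨α, hα, hq, r, hr, hur⟩ := sqclass _ _ _ ht h'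
  have hdv : α.natAbs ∣ 1 := by
    apply natAbs_dvd_of_sqfree hα
    intro q hqp hqα
    have h1 := hq q hqp hqα
    norm_num at h1
    exact_mod_cast Int.natCast_dvd_natCast.mp (by simpa using h1)
  have h1 : α = 1 ∨ α = -1 := by
    have : α.natAbs = 1 := Nat.dvd_one.mp hdv
    omega
  rcases h1 with h1 | h1
  · subst h1
    exact ⟨r, hr, by rw [hur]; norm_num⟩
  · exfalso
    subst h1
    have hneg : t < 0 := by
      rw [hur]; push_cast
      have : 0 < r ^ 2 := by positivity
      linarith
    have : 0 < t ^ 2 - 66 * t + 1 := by nlinarith [sq_nonneg t]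
    nlinarith [sq_nonneg w, mul_pos (neg_pos.mpr hneg) this]

theorem evenq_aux {A n e w : ℤ} (hA : A % 2 = 1) (he : e % 2 = 1)
    (h : w ^ 2 = A * (8 * A ^ 2 * n ^ 4 + 33 * A * n ^ 2 * e ^ 2 + 34 * e ^ 4)) : False := by
  obtain ⟨k, rfl⟩ : ∃ k, A = 2 * k + 1 := ⟨A / 2, by omega⟩
  obtain ⟨f, rfl⟩ : ∃ f, e = 2 * f + 1 := ⟨e / 2, by omega⟩
  have h8 := congrArg (fun t : ℤ => (t : ZMod 8)) h
  push_cast at h8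
  generalize (w : ZMod 8) = w' at h8
  generalize (k : ZMod 8) = k' at h8
  generalize (n : ZMod 8) = n' at h8
  generalize (f : ZMod 8) = f' at h8
  revert w' k' n' f'
  decide +kernel

theorem evenq_aux2 {A m e w : ℤ} (hA : A % 2 = 1) (he : e % 2 = 1) (hm : m % 2 = 1)
    (h : w ^ 2 = A * (2 * A ^ 2 * m ^ 4 + 33 * A * m ^ 2 * e ^ 2 + 136 * e ^ 4)) : False := by
  obtain ⟨k, rfl⟩ : ∃ k, A = 2 * k + 1 := ⟨A / 2, by omega⟩
  obtain ⟨f, rfl⟩ : ∃ f, e = 2 * f + 1 := ⟨e / 2, by omega⟩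
  obtain ⟨n, rfl⟩ : ∃ n, m = 2 * n + 1 := ⟨m / 2, by omega⟩
  have h8 := congrArg (fun t : ℤ => (t : ZMod 8)) h
  push_cast at h8
  generalize (w : ZMod 8) = w' at h8
  generalize (k : ZMod 8) = k' at h8
  generalize (n : ZMod 8) = n' at h8
  generalize (f : ZMod 8) = f' at h8
  revert w' k' n' f'
  decide +kernel

theorem evenq_of_sq {w N : ℤ} (h : w ^ 2 = 2 * N) : ∃ w', w = 2 * w' :=
  Int.prime_two.dvd_of_dvd_pow ⟨N, h⟩

theorem evenq_excl {A m e w : ℤ} (hA : A % 2 = 1) (hcop : IsCoprime m e)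
    (h : w ^ 2 = (2 * A) * ((2 * A) ^ 2 * m ^ 4 + 33 * (2 * A) * m ^ 2 * e ^ 2 + 272 * e ^ 4)) :
    False := by
  obtain ⟨w, rfl⟩ := evenq_of_sq (h.trans (mul_assoc _ _ _))
  have h1 : w ^ 2 = A * (2 * A ^ 2 * m ^ 4 + 33 * A * m ^ 2 * e ^ 2 + 136 * e ^ 4) := by
    linarith
  rcases Int.emod_two_eq_zero_or_one e with he | he
  · have hm : m % 2 = 1 := by
      rcases Int.emod_two_eq_zero_or_one m with hm | hm
      · exact absurd (hcop.isUnit_of_dvd' (Int.dvd_of_emod_eq_zero hm) (Int.dvd_of_emod_eq_zero he))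
          Int.prime_two.not_isUnit
      · exact hm
    obtain ⟨f, rfl⟩ : ∃ f, e = 2 * f := ⟨e / 2, by omega⟩
    obtain ⟨w, rfl⟩ := evenq_of_sq
      (N := A * (A ^ 2 * m ^ 4 + 66 * A * m ^ 2 * f ^ 2 + 1088 * f ^ 4)) (by rw [h1]; ring)
    have h2 : 2 * w ^ 2 = A * (A ^ 2 * m ^ 4 + 66 * A * m ^ 2 * f ^ 2 + 1088 * f ^ 4) := by
      linarith
    obtain ⟨k, rfl⟩ : ∃ k, A = 2 * k + 1 := ⟨A / 2, by omega⟩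
    obtain ⟨n, rfl⟩ : ∃ n, m = 2 * n + 1 := ⟨m / 2, by omega⟩
    have h8 := congrArg (fun t : ℤ => (t : ZMod 2)) h2
    push_cast at h8
    generalize (w : ZMod 2) = w' at h8
    generalize (k : ZMod 2) = k' at h8
    generalize (n : ZMod 2) = n' at h8
    generalize (f : ZMod 2) = f' at h8
    revert w' k' n' f'
    decide +kernel
  · rcases Int.emod_two_eq_zero_or_one m with hm | hm
    · obtain ⟨n, rfl⟩ : ∃ n, m = 2 * n := ⟨m / 2, by omega⟩
      obtain ⟨w, rfl⟩ := evenq_of_sq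
        (N := 2 * (A * (8 * A ^ 2 * n ^ 4 + 33 * A * n ^ 2 * e ^ 2 + 34 * e ^ 4)))
        (by rw [h1]; ring)
      exact evenq_aux hA he (n := n) (w := w) (by linarith)
    · exact evenq_aux2 hA he hm h1

theorem E2q_class {u v : ℚ} (hu : u ≠ 0) (h : v ^ 2 = u * (u + 16) * (u + 17)) :
    ∃ r : ℚ, r ≠ 0 ∧ (u = r ^ 2 ∨ u = -r ^ 2 ∨ u = 17 * r ^ 2 ∨ u = -17 * r ^ 2) := by
  have h' : ((1 : ℤ) : ℚ) * v ^ 2 = u * (u ^ 2 + (33 : ℤ) * u + (272 : ℤ)) := by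
    push_cast; rw [h]; ring
  obtain ⟨α, hα, hq, r, hr, hur⟩ := sqclass _ _ _ hu h'
  obtain ⟨w, hw⟩ := integral_model squarefree_one hr hur h'
  have hcop := coprime_num_den r
  have hdv : α.natAbs ∣ [2, 17].prod := by
    apply natAbs_dvd_of_sqfree hα
    intro q hqp hqα
    have h1 : (q : ℤ) ∣ 1 * 272 := hq q hqp hqα
    have hqp' : Prime (q : ℤ) := Nat.prime_iff_prime_int.mp hqp
    have h2 : ([2, 17].prod : ℕ) = 2 * 17 := by norm_num
    rw [h2]
    suffices hh : (q : ℤ) ∣ 2 * 17 by exact_mod_cast hh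
    have h3 : (q : ℤ) ∣ 2 ^ 4 * 17 := by norm_num at h1 ⊢; exact h1
    rcases hqp'.dvd_or_dvd h3 with h4 | h4
    · exact (hqp'.dvd_of_dvd_pow h4).mul_right _
    · exact h4.mul_left _
  have hmem := listOf_mem _ (by norm_num) _ hdv
  have hodd : α % 2 = 1 := by
    rcases Int.emod_two_eq_zero_or_one α with h0 | h0
    · exfalso
      obtain ⟨A, rfl⟩ : ∃ A, α = 2 * A := ⟨α / 2, by omega⟩
      refine evenq_excl (A := A) (w := w) ?_ hcop (by rw [← hw]; ring)
      rcases Int.emod_two_eq_zero_or_one A with h1 | h1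
      · exact absurd (hα 2 (mul_dvd_mul_left _ (Int.dvd_of_emod_eq_zero h1)))
          Int.prime_two.not_isUnit
      · exact h1
    · exact h0
  have hn : α.natAbs = 1 ∨ α.natAbs = 17 ∨ α.natAbs = 2 ∨ α.natAbs = 34 := by
    simpa [listOf] using hmem
  have hc : α = 1 ∨ α = -1 ∨ α = 17 ∨ α = -17 := by omega
  refine ⟨r, hr, ?_⟩
  rcases hc with h1 | h1 | h1 | h1 <;> subst h1 <;> rw [hur] <;> norm_num

theorem E3_up {u v s : ℚ} (hu0 : u ≠ 0) (hu : u = s ^ 2)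
    (h : v ^ 2 = u * (u + 16) * (u + 17)) :
    ∃ t w : ℚ, t ≠ 0 ∧ w ^ 2 = t * (t ^ 2 - 66 * t + 1) ∧
      ∀ T, u * T = (u + 16) * (u + 17) → 4 * t * (t ^ 2 - 66 * t + 1) * T = (t ^ 2 - 1) ^ 2 := by
  have hs : s ≠ 0 := by rintro rfl; apply hu0; rw [hu]; ring
  obtain ⟨y, hy⟩ : ∃ y, y = v / s := ⟨_, rfl⟩
  have hv : v = y * s := by rw [hy]; field_simp
  have hy2 : y ^ 2 = (u + 16) * (u + 17) := by
    apply mul_left_cancel₀ hu0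
    rw [hv] at h
    linear_combination h + y ^ 2 * hu
  obtain ⟨t, ht⟩ : ∃ t, t = 33 + 2 * u + 2 * y := ⟨_, rfl⟩
  have hq : t ^ 2 - 66 * t + 1 = 4 * u * t := by
    rw [ht]; linear_combination 4 * hy2
  have ht0 : t ≠ 0 := by rintro rfl; norm_num at hq
  refine ⟨t, 2 * t * s, ht0, ?_, ?_⟩
  · rw [hq]; linear_combination -4 * t ^ 2 * hu
  · intro T hT
    rw [hq]
    linear_combination 16 * t ^ 2 * hT - (t ^ 2 + 66 * t + 1 + 4 * u * t) * hq

theorem E3_half_a {u v t s : ℚ} (hu0 : u ≠ 0) (hu : u = s ^ 2 ∨ u = -s ^ 2)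
    (h : v ^ 2 = u * (u + 16) * (u + 17)) (ht : t ≠ 0)
    (hut : u * t = (u + 16) * (u + 17)) :
    ∃ t' w' T : ℚ, t' ≠ 0 ∧ w' ^ 2 = t' * (t' ^ 2 - 66 * t' + 1) ∧
      (T = t ∨ T = 1 / t) ∧
      4 * t' * (t' ^ 2 - 66 * t' + 1) * T = (t' ^ 2 - 1) ^ 2 := by
  rcases hu with hu | hu
  · obtain ⟨t', w', h2, h3, h4⟩ := E3_up hu0 hu h
    exact ⟨t', w', t, h2, h3, Or.inl rfl, h4 _ hut⟩
  · have hne : u * t ≠ 0 := mul_ne_zero hu0 ht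
    rw [hut] at hne
    have h1 : u + 16 ≠ 0 := left_ne_zero_of_mul hne
    have h17 : u + 17 ≠ 0 := right_ne_zero_of_mul hne
    have hs : s ≠ 0 := by rintro rfl; apply hu0; rw [hu]; ring
    have hs2 : s ^ 2 = -u := by rw [hu]; ring
    obtain ⟨t', w', h2, h3, h4⟩ := E3_up (u := -16 * (u + 17) / (u + 16))
      (v := 16 * v / (u + 16) ^ 2)
      (s := 4 * v / (s * (u + 16))) (div_ne_zero (mul_ne_zero (by norm_num) h17) h1)
      (by
        rw [div_pow, mul_pow, mul_pow, hs2]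
        field_simp
        linear_combination 16 * h)
      (by
        field_simp
        linear_combination h)
    refine ⟨t', w', 1 / t, h2, h3, Or.inr rfl, h4 _ ?_⟩
    have h5 : t = (u + 16) * (u + 17) / u := by field_simp; linear_combination hut
    rw [h5]
    field_simp
    ring

theorem E3_half {t w : ℚ} (ht : t ≠ 0) (h : w ^ 2 = t * (t ^ 2 - 66 * t + 1)) :
    ∃ t' w' T : ℚ, t' ≠ 0 ∧ w' ^ 2 = t' * (t' ^ 2 - 66 * t' + 1) ∧
      (T = t ∨ T = 1 / t) ∧
      4 * t' * (t' ^ 2 - 66 * t' + 1) * T = (t' ^ 2 - 1) ^ 2 := by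
  obtain ⟨r, hr, htr⟩ := E3_class ht h
  obtain ⟨y, hy⟩ : ∃ y, y = w / r := ⟨_, rfl⟩
  have hw : w = y * r := by rw [hy]; field_simp
  have hy2 : y ^ 2 = t ^ 2 - 66 * t + 1 := by
    apply mul_left_cancel₀ ht
    rw [← h, hw]; linear_combination y ^ 2 * htr
  obtain ⟨u, hu⟩ : ∃ u, u = (t - 33 + y) / 2 := ⟨_, rfl⟩
  have hut : u * t = (u + 16) * (u + 17) := by rw [hu]; linear_combination -hy2 / 4
  have hu0 : u ≠ 0 := by rintro h0; rw [h0] at hut; norm_num at hut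
  have h2 : (u * r) ^ 2 = u * (u + 16) * (u + 17) := by
    linear_combination u * hut - u ^ 2 * htr
  obtain ⟨s, hs, hcl⟩ := E2q_class hu0 h2
  rcases hcl with h3 | h3 | h3 | h3
  · exact E3_half_a hu0 (Or.inl h3) h2 ht hut
  · exact E3_half_a hu0 (Or.inr h3) h2 ht hut
  · refine E3_half_a (u := 272 / u) (v := 272 * (u * r) / u ^ 2) (s := 4 / s)
      (div_ne_zero (by norm_num) hu0) (Or.inl ?_) ?_ ht ?_
    · rw [h3]; field_simp; norm_num
    · field_simp at h2 ⊢; linear_combination 272 * h2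
    · field_simp; linear_combination 272 * hut
  · refine E3_half_a (u := 272 / u) (v := 272 * (u * r) / u ^ 2) (s := 4 / s)
      (div_ne_zero (by norm_num) hu0) (Or.inr ?_) ?_ ht ?_
    · rw [h3]; field_simp; norm_num
    · field_simp at h2 ⊢; linear_combination 272 * h2
    · field_simp; linear_combination 272 * hut

theorem dblq_val {t T r : ℚ} (ht : t ≠ 0) (hT : T ≠ 0) (hr0 : r ≠ 0) (hr : t = r ^ 2)
    (h : 4 * t * (t ^ 2 - 66 * t + 1) * T = (t ^ 2 - 1) ^ 2) :
    (padicValRat 2 t < 0 → padicValRat 2 T = padicValRat 2 t - 2) ∧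
    (0 < padicValRat 2 t → padicValRat 2 T = -2 - padicValRat 2 t) ∧
    (padicValRat 2 t = 0 → padicValRat 2 T ≠ 0) := by
  have hB : t ^ 2 - 66 * t + 1 ≠ 0 := by
    intro h0
    rw [h0] at h
    have h1 : t ^ 2 - 1 = 0 := by
      have : (t ^ 2 - 1) ^ 2 = 0 := by rw [← h]; ring
      simpa using this
    have h2 : t = 1 / 33 := by linarith
    rw [h2] at h1; norm_num at h1
  have hC : t ^ 2 - 1 ≠ 0 := by
    intro h0
    rw [h0] at h
    have : 4 * t * (t ^ 2 - 66 * t + 1) * T ≠ 0 :=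
      mul_ne_zero (mul_ne_zero (mul_ne_zero (by norm_num) ht) hB) hT
    apply this; rw [h]; norm_num
  have v4 : padicValRat 2 (4 : ℚ) = 2 := by
    have := val_two_pow 2; norm_num at this; exact this
  have v8 : padicValRat 2 (8 : ℚ) = 3 := by
    have := val_two_pow 3; norm_num at this; exact this
  have v1 : padicValRat 2 (1 : ℚ) = 0 := by simp
  have vm1 : padicValRat 2 (-1 : ℚ) = 0 := by rw [padicValRat.neg]; exact v1
  have v66 : padicValRat 2 (-66 : ℚ) = 1 := by
    have h33 := val_odd (n := -33) (by norm_num)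
    have h2 := val_two_pow 1
    rw [pow_one] at h2
    rw [show (-66 : ℚ) = ((-33 : ℤ) : ℚ) * 2 by norm_num, padicValRat.mul (by norm_num) (by norm_num),
      h33, h2]; norm_num
  have v66t : padicValRat 2 (-66 * t) = 1 + padicValRat 2 t := by
    rw [padicValRat.mul (by norm_num) ht, v66]
  have ht2 : t ^ 2 ≠ 0 := pow_ne_zero _ ht
  have vt2 := val_sq ht
  have key : 2 + padicValRat 2 t + padicValRat 2 (t ^ 2 - 66 * t + 1) + padicValRat 2 T
      = 2 * padicValRat 2 (t ^ 2 - 1) := by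
    rw [← val_sq hC, ← h, padicValRat.mul (mul_ne_zero (mul_ne_zero (by norm_num) ht) hB) hT,
      padicValRat.mul (mul_ne_zero (by norm_num) ht) hB, padicValRat.mul (by norm_num) ht, v4]
  refine ⟨?_, ?_, ?_⟩
  · intro hneg
    have h1 := val_add (x := t ^ 2) (y := -66 * t) ht2 (Or.inr (by rw [vt2, v66t]; linarith))
    have h2 := val_add (x := t ^ 2 + -66 * t) (y := 1) h1.1
      (Or.inr (by rw [h1.2, vt2, v1]; linarith))
    have h3 := val_add (x := t ^ 2) (y := -1) ht2 (Or.inr (by rw [vt2, vm1]; linarith))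
    rw [← sub_eq_add_neg] at h3
    rw [show (t ^ 2 + -66 * t + 1 : ℚ) = t ^ 2 - 66 * t + 1 by ring] at h2
    rw [h2.2, h1.2, h3.2, vt2] at key
    linarith
  · intro hpos
    have h1 := val_add (x := 1) (y := -66 * t) (by norm_num) (Or.inr (by rw [v66t, v1]; linarith))
    have h2 := val_add (x := 1 + -66 * t) (y := t ^ 2) h1.1
      (Or.inr (by rw [h1.2, vt2, v1]; linarith))
    have h3 := val_add (x := -1) (y := t ^ 2) (by norm_num) (Or.inr (by rw [vt2, vm1]; linarith))
    rw [show (1 + -66 * t + t ^ 2 : ℚ) = t ^ 2 - 66 * t + 1 by ring] at h2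
    rw [show (-1 + t ^ 2 : ℚ) = t ^ 2 - 1 by ring] at h3
    rw [h2.2, h1.2, h3.2, v1, vm1] at key
    linarith
  · intro h0 hT0
    have hvr : padicValRat 2 r = 0 := by
      rw [hr, val_sq hr0] at h0; linarith
    have ht1 : t - 1 ≠ 0 := by
      intro h5; apply hC; linear_combination (t + 1) * h5
    have h3 := val_sq_sub hr0 hvr (by rw [← hr]; exact ht1)
    rw [← hr] at h3
    obtain ⟨k, hk⟩ : ∃ k, t = 1 + 8 * k := ⟨(t - 1) / 8, by ring⟩
    have hk0 : k ≠ 0 := by rintro rfl; apply ht1; rw [hk]; ring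
    have hvk : 0 ≤ padicValRat 2 k := by
      rw [show t - 1 = 8 * k by rw [hk]; ring, padicValRat.mul (by norm_num) hk0, v8] at h3
      linarith
    have h4 : t * (k ^ 2 - 8 * k - 1) * T = k ^ 2 * (4 * k + 1) ^ 2 := by
      have e1 : t ^ 2 - 66 * t + 1 = 64 * (k ^ 2 - 8 * k - 1) := by rw [hk]; ring
      have e2 : t ^ 2 - 1 = 16 * k * (4 * k + 1) := by rw [hk]; ring
      rw [e1, e2] at h
      linarith
    have hQ : k ^ 2 - 8 * k - 1 ≠ 0 := by
      intro h5; apply hB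
      rw [hk]; linear_combination 64 * h5
    have h5 := val_add (x := 1) (y := 4 * k) (by norm_num)
      (Or.inr (by rw [padicValRat.mul (by norm_num) hk0, v4, v1]; linarith))
    rw [add_comm] at h5
    have hk2 : k ^ 2 ≠ 0 := pow_ne_zero _ hk0
    have h6 := congrArg (padicValRat 2) h4
    rw [padicValRat.mul (mul_ne_zero ht hQ) hT, padicValRat.mul ht hQ,
      padicValRat.mul hk2 (pow_ne_zero _ h5.1), val_sq hk0, val_sq h5.1, h5.2, v1, h0, hT0] at h6
    have v8k : padicValRat 2 (-8 * k) = 3 + padicValRat 2 k := by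
      rw [padicValRat.mul (by norm_num) hk0, padicValRat.neg, v8]
    rcases hvk.eq_or_lt with h7 | h7
    · have h8 : 3 ≤ padicValRat 2 (k ^ 2 - 8 * k - 1) := by
        by_cases h9 : k ^ 2 - 1 = 0
        · rw [show k ^ 2 - 8 * k - 1 = -8 * k by linear_combination h9, v8k]; linarith
        · have h10 := val_sq_sub hk0 h7.symm h9
          have h11 := padicValRat.min_le_padicValRat_add (p := 2) (q := k ^ 2 - 1) (r := -8 * k)
            (by rw [show k ^ 2 - 1 + -8 * k = k ^ 2 - 8 * k - 1 by ring]; exact hQ)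
          rw [show k ^ 2 - 1 + -8 * k = k ^ 2 - 8 * k - 1 by ring] at h11
          refine le_trans (le_min h10 ?_) h11
          rw [v8k]; linarith
      omega
    · have h8 := val_add (x := -1) (y := k ^ 2) (by norm_num)
        (Or.inr (by rw [val_sq hk0, vm1]; linarith))
      have h9 := val_add (x := -1 + k ^ 2) (y := -8 * k) h8.1
        (Or.inr (by rw [h8.2, v8k, vm1]; linarith))
      rw [show -1 + k ^ 2 + -8 * k = k ^ 2 - 8 * k - 1 by ring] at h9
      rw [h9.2, h8.2, vm1] at h6
      omega

theorem E3_val_T {t T : ℚ} (ht : t ≠ 0) (hT : T = t ∨ T = 1 / t) :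
    T ≠ 0 ∧ (padicValRat 2 T = padicValRat 2 t ∨ padicValRat 2 T = - padicValRat 2 t) := by
  rcases hT with rfl | rfl
  · exact ⟨ht, Or.inl rfl⟩
  · refine ⟨div_ne_zero (by norm_num) ht, Or.inr ?_⟩
    rw [padicValRat.div (by norm_num) ht]; simp

theorem E3_good {t w : ℚ} (ht : t ≠ 0) (h : w ^ 2 = t * (t ^ 2 - 66 * t + 1)) :
    padicValRat 2 t ≠ 0 := by
  obtain ⟨t', w', T, ht', h', hT, hd⟩ := E3_half ht h
  obtain ⟨hT0, hTv⟩ := E3_val_T ht hT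
  obtain ⟨r, hr0, hr⟩ := E3_class ht' h'
  obtain ⟨h1, h2, h3⟩ := dblq_val ht' hT0 hr0 hr hd
  rcases lt_trichotomy (padicValRat 2 t') 0 with c | c | c
  · have := h1 c; omega
  · have := h3 c; omega
  · have := h2 c; omega

theorem E3_none : ∀ (N : ℕ) (t w : ℚ), t ≠ 0 → w ^ 2 = t * (t ^ 2 - 66 * t + 1) →
    |padicValRat 2 t| ≤ N → False := by
  intro N
  induction N with
  | zero =>
    intro t w ht h hN
    have := E3_good ht h
    have h2 := abs_le.mp hN
    push_cast at h2
    omega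
  | succ N ih =>
    intro t w ht h hN
    obtain ⟨t', w', T, ht', h', hT, hd⟩ := E3_half ht h
    obtain ⟨hT0, hTv⟩ := E3_val_T ht hT
    obtain ⟨r, hr0, hr⟩ := E3_class ht' h'
    obtain ⟨h1, h2, h3⟩ := dblq_val ht' hT0 hr0 hr hd
    apply ih t' w' ht' h'
    have h4 := abs_le.mp hN
    rw [abs_le]
    push_cast at h4
    rcases lt_or_gt_of_ne (E3_good ht' h') with c | c
    · have := h1 c
      omega
    · have := h2 c
      omega

/-- rational points on the curve itself -/
theorem rat_points {U V : ℚ} (h : V ^ 2 = U * (U ^ 2 + 30 * U + 289)) : U = 0 ∨ U = 17 := by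
  by_contra hcon
  push Not at hcon
  obtain ⟨hU, hU17⟩ := hcon
  have hq : U ^ 2 + 30 * U + 289 ≠ 0 := by nlinarith [sq_nonneg (U + 15)]
  obtain ⟨u, hu⟩ : ∃ u, u = (U ^ 2 + 30 * U + 289) / U / 4 - 16 := ⟨_, rfl⟩
  obtain ⟨v, hv⟩ : ∃ v, v = V * (U ^ 2 - 289) / U ^ 2 / 8 := ⟨_, rfl⟩
  have h2 : v ^ 2 = u * (u + 16) * (u + 17) := by
    rw [hu, hv]; field_simp; linear_combination 64 * (U ^ 2 - 289) ^ 2 * h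
  have hu1 : u + 16 ≠ 0 := by
    rw [hu, sub_add_cancel]
    exact div_ne_zero (div_ne_zero hq hU) (by norm_num)
  have hu17 : u + 17 ≠ 0 := by
    intro h0
    have : (U + 17) ^ 2 = 0 := by
      rw [hu] at h0; field_simp at h0; linear_combination h0
    have h3 : U = -17 := by
      have : U + 17 = 0 := by simpa using this
      linarith
    rw [h3] at h
    nlinarith [sq_nonneg V]
  have hu0 : u ≠ 0 := by
    intro h0
    have : (U - 17) ^ 2 = 0 := by
      rw [hu] at h0; field_simp at h0; linear_combination h0
    apply hU17
    have : U - 17 = 0 := by simpa using this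
    linarith
  refine E3_none _ ((u + 16) * (u + 17) / u) (v * (u ^ 2 - 272) / u ^ 2) ?_ ?_
    (Int.abs_eq_natAbs _).le
  · exact div_ne_zero (mul_ne_zero hu1 hu17) hu0
  · field_simp
    linear_combination (u ^ 2 - 272) ^ 2 * h2

theorem no_sq {a b : ℚ} {D : ℤ} (hD : Squarefree D) (hD1 : 1 < D) (h : a ^ 2 = D * b ^ 2) :
    a = 0 ∧ b = 0 := by
  have hD0 : (D : ℚ) ≠ 0 := by exact_mod_cast (by omega : D ≠ 0)
  have ha : a = 0 := by
    by_contra ha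
    have h4 : (D : ℚ) * (b / a) ^ 2 = (1 : ℤ) := by
      push_cast; field_simp; linear_combination -h
    obtain ⟨k, hk⟩ := int_of_sqfree hD h4
    rw [hk] at h4
    have h5 : D * k ^ 2 = 1 := by exact_mod_cast h4
    have h6 : D ∣ 1 := ⟨_, h5.symm⟩
    have := Int.le_of_dvd one_pos h6
    omega
  refine ⟨ha, ?_⟩
  rw [ha] at h
  have : D * b ^ 2 = (0 : ℚ) := by rw [← h]; norm_num
  simpa [hD0] using this

theorem indep {z : ℝ} (hz : z ^ 2 = 318049) {a b : ℚ} (h : (a : ℝ) + b * z = 0) :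
    a = 0 ∧ b = 0 := by
  apply no_sq sqf_d (by norm_num)
  have : (a : ℝ) ^ 2 = 318049 * (b : ℝ) ^ 2 := by
    rw [← hz]; linear_combination (a - b * z) * h
  exact_mod_cast this

theorem field_rep {z : ℝ} (hz : z ^ 2 = 318049) {x : ℝ} (hx : x ∈ ℚ⟮z⟯) :
    ∃ a b : ℚ, x = a + b * z := by
  induction hx using IntermediateField.adjoin_induction with
  | mem x hx =>
    rw [Set.mem_singleton_iff] at hx
    exact ⟨0, 1, by rw [hx]; push_cast; ring⟩
  | algebraMap x => exact ⟨x, 0, by simp⟩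
  | add x y _ _ h1 h2 =>
    obtain ⟨a, b, rfl⟩ := h1
    obtain ⟨c, d, rfl⟩ := h2
    exact ⟨a + c, b + d, by push_cast; ring⟩
  | mul x y _ _ h1 h2 =>
    obtain ⟨a, b, rfl⟩ := h1
    obtain ⟨c, d, rfl⟩ := h2
    exact ⟨a * c + 318049 * b * d, a * d + b * c, by push_cast; rw [← hz]; ring⟩
  | inv x _ h1 =>
    obtain ⟨a, b, rfl⟩ := h1
    by_cases hN : a ^ 2 - 318049 * b ^ 2 = 0
    · have := no_sq (a := a) (b := b) sqf_d (by norm_num) (by push_cast; linarith)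
      rw [this.1, this.2]
      exact ⟨0, 0, by simp⟩
    · refine ⟨a / (a ^ 2 - 318049 * b ^ 2), -b / (a ^ 2 - 318049 * b ^ 2), ?_⟩
      have hN' : (a : ℝ) ^ 2 - 318049 * (b : ℝ) ^ 2 ≠ 0 := by exact_mod_cast hN
      have hab : (a : ℝ) + b * z ≠ 0 := by
        intro h0
        apply hN'
        rw [← hz]; linear_combination (a - b * z) * h0
      push_cast
      apply inv_eq_of_mul_eq_one_right
      generalize hNN : (a : ℝ) ^ 2 - 318049 * (b : ℝ) ^ 2 = N at hN'
      have h3 : ((a : ℝ) + b * z) * (a / N + -b / N * z) = (a ^ 2 - b ^ 2 * z ^ 2) / N := by ring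
      rw [h3, hz, div_eq_one_iff_eq hN', ← hNN]
      ring

theorem cubic_rat {a b p q : ℚ}
    (h1 : p ^ 2 + 318049 * q ^ 2 =
      a ^ 3 + 3 * a * b ^ 2 * 318049 + 30 * (a ^ 2 + 318049 * b ^ 2) + 289 * a)
    (h2 : 2 * p * q = 3 * a ^ 2 * b + b ^ 3 * 318049 + 60 * a * b + 289 * b) :
    b = 0 ∧ (a = 0 ∨ a = 17) := by
  by_cases hb : b = 0
  · subst hb
    refine ⟨rfl, ?_⟩
    have h3 : p * q = 0 := by linarith
    rcases mul_eq_zero.mp h3 with h4 | h4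
    · subst h4
      left
      exact twist_none (V := q) (by linear_combination h1)
    · subst h4
      exact rat_points (V := p) (by linear_combination h1)
  · exfalso
    obtain ⟨l, hl⟩ : ∃ l, q = l * b := ⟨q / b, by field_simp⟩
    obtain ⟨k, hk⟩ : ∃ k, p = k * b * 318049 := ⟨p / (b * 318049), by field_simp⟩
    have h3 : 2 * p * l = 3 * a ^ 2 + b ^ 2 * 318049 + 60 * a + 289 := by
      apply mul_right_cancel₀ hb
      rw [hl] at h2; linear_combination h2
    have h4 : 2 * (k * 318049) * q = 3 * a ^ 2 + b ^ 2 * 318049 + 60 * a + 289 := by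
      apply mul_right_cancel₀ hb
      rw [hk] at h2; linear_combination h2
    have hU3 := rat_points (U := l ^ 2 - 30 - 2 * a) (V := l * (l ^ 2 - 30 - 2 * a - a) + p) (by
      rw [hl] at h1
      linear_combination h1 + (l ^ 2 - 30 - 2 * a - a) * h3)
    have hU4 := twist_none (U := 318049 * k ^ 2 - 30 - 2 * a)
      (V := k * (318049 * k ^ 2 - 30 - 2 * a - a) + q) (by
      rw [hk] at h1
      linear_combination h1 + (318049 * k ^ 2 - 30 - 2 * a - a) * h4)
    have hka : q = k * a := by
      have : 318049 * (k * (318049 * k ^ 2 - 30 - 2 * a - a) + q) ^ 2 = 0 := by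
        have e : 318049 * (k * (318049 * k ^ 2 - 30 - 2 * a - a) + q) ^ 2 =
            (318049 * k ^ 2 - 30 - 2 * a) * ((318049 * k ^ 2 - 30 - 2 * a) ^ 2
              + 30 * (318049 * k ^ 2 - 30 - 2 * a) + 289) := by
          rw [hk] at h1
          linear_combination h1 + (318049 * k ^ 2 - 30 - 2 * a - a) * h4
        rw [e, hU4]; ring
      have h5 : k * (318049 * k ^ 2 - 30 - 2 * a - a) + q = 0 := by simpa using this
      linear_combination h5 - k * hU4
    have hN : a ^ 2 - 318049 * b ^ 2 = 289 := by
      rw [hka] at h4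
      linear_combination h4 - 2 * a * hU4
    have hlk : l * b = k * a := by rw [← hl, hka]
    rcases hU3 with h5 | h5
    · have hp : p = l * a := by
        have e : (l * (l ^ 2 - 30 - 2 * a - a) + p) ^ 2 = (l ^ 2 - 30 - 2 * a) *
            ((l ^ 2 - 30 - 2 * a) ^ 2 + 30 * (l ^ 2 - 30 - 2 * a) + 289) := by
          rw [hl] at h1
          linear_combination h1 + (l ^ 2 - 30 - 2 * a - a) * h3
        rw [h5] at e
        have h6 : l * (0 - a) + p = 0 := by
          have : (l * (0 - a) + p) ^ 2 = 0 := by rw [e]; ring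
          simpa using this
        linear_combination h6
      have hk0 : k = 0 := by
        have : 289 * k = 0 := by
          linear_combination (-k) * hN + (-a) * hlk - b * (hp - hk)
        linarith
      rw [hk0] at hU4
      have ha : a = -15 := by linarith
      rw [ha] at hN
      nlinarith [sq_nonneg b]
    · have h6 : a ^ 2 = ((17 : ℤ) : ℚ) * l ^ 2 := by
        push_cast
        have hl2 : l ^ 2 = 47 + 2 * a := by linear_combination h5
        have hk2 : 318049 * k ^ 2 = 30 + 2 * a := by linear_combination hU4
        have e1 : l ^ 2 * (318049 * b ^ 2) = 318049 * k ^ 2 * a ^ 2 := by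
          linear_combination 318049 * (l * b + k * a) * hlk
        rw [hk2, hl2] at e1
        rw [hl2]
        linear_combination e1 / 17 + (47 + 2 * a) * hN / 17
      have h7 := no_sq sqf17 (by norm_num) h6
      rw [h7.1, h7.2] at h5
      norm_num at h5

theorem real_pts {z : ℝ} (hz : z ^ 2 = 318049) {x y : ℝ} (hx : x ∈ ℚ⟮z⟯) (hy : y ∈ ℚ⟮z⟯)
    (h : y ^ 2 + x * y + y = x ^ 3 - x ^ 2 - x - 14) :
    (x = 11 / 4 ∧ y = -15 / 8) ∨ (x = 7 ∧ y = 13) ∨ (x = 7 ∧ y = -21) := by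
  obtain ⟨a, b, hab⟩ := field_rep hz hx
  obtain ⟨c, e, hce⟩ := field_rep hz hy
  obtain ⟨A, hA⟩ : ∃ A, A = 4 * a - 11 := ⟨_, rfl⟩
  obtain ⟨B, hB⟩ : ∃ B, B = 4 * b := ⟨_, rfl⟩
  obtain ⟨P, hP⟩ : ∃ P, P = 4 * (2 * c + a + 1) := ⟨_, rfl⟩
  obtain ⟨Q, hQ⟩ : ∃ Q, Q = 4 * (2 * e + b) := ⟨_, rfl⟩
  have hU : 4 * x - 11 = (A : ℝ) + B * z := by rw [hA, hB, hab]; push_cast; ring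
  have hV : 4 * (2 * y + x + 1) = (P : ℝ) + Q * z := by
    rw [hP, hQ, hab, hce]; push_cast; ring
  have hE : (4 * (2 * y + x + 1)) ^ 2 =
      (4 * x - 11) ^ 3 + 30 * (4 * x - 11) ^ 2 + 289 * (4 * x - 11) := by
    linear_combination 64 * h
  have hE' := hE
  rw [hU, hV] at hE'
  have hI := indep hz (a := P ^ 2 + 318049 * Q ^ 2 -
      (A ^ 3 + 3 * A * B ^ 2 * 318049 + 30 * (A ^ 2 + 318049 * B ^ 2) + 289 * A))
    (b := 2 * P * Q - (3 * A ^ 2 * B + B ^ 3 * 318049 + 60 * A * B + 289 * B)) (by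
      push_cast
      rw [← hz]
      linear_combination hE')
  obtain ⟨hB0, hA0⟩ := cubic_rat (sub_eq_zero.mp hI.1) (sub_eq_zero.mp hI.2)
  rw [hB0] at hU
  rcases hA0 with h0 | h0
  · left
    rw [h0] at hU
    have hx' : x = 11 / 4 := by push_cast at hU; linarith
    refine ⟨hx', ?_⟩
    rw [hx'] at hE
    have : (4 * (2 * y + 11 / 4 + 1)) ^ 2 = 0 := by rw [hE]; norm_num
    have h3 : 4 * (2 * y + 11 / 4 + 1) = 0 := by
      exact pow_eq_zero_iff (two_ne_zero) |>.mp this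
    linarith
  · right
    rw [h0] at hU
    have hx' : x = 7 := by push_cast at hU; linarith
    rw [hx'] at h
    have : (y - 13) * (y + 21) = 0 := by linear_combination h
    rcases mul_eq_zero.mp this with h3 | h3
    · exact Or.inl ⟨hx', by linarith⟩
    · exact Or.inr ⟨hx', by linarith⟩

theorem K_pts {z : ℝ} (hz : z ^ 2 = 318049) {x y : ℚ⟮z⟯} (h : (X0_17 ℚ⟮z⟯).Nonsingular x y) :
    (x = 11 / 4 ∧ y = -15 / 8) ∨ (x = 7 ∧ y = 13) ∨ (x = 7 ∧ y = -21) := by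
  have h1 := ((X0_17 ℚ⟮z⟯).equation_iff x y).mp h.1
  simp only [X0_17] at h1
  have h2 : (y : ℝ) ^ 2 + x * y + y = (x : ℝ) ^ 3 - (x : ℝ) ^ 2 - x - 14 := by
    have h3 : y ^ 2 + x * y + y = x ^ 3 - x ^ 2 - x - 14 := by linear_combination h1
    have := congrArg (fun t : ℚ⟮z⟯ => (t : ℝ)) h3
    push_cast at this
    exact this
  rcases real_pts hz x.2 y.2 h2 with h3 | h3 | h3
  · left; exact ⟨Subtype.ext (by push_cast; exact h3.1), Subtype.ext (by push_cast; exact h3.2)⟩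
  · right; left
    exact ⟨Subtype.ext (by push_cast; exact h3.1), Subtype.ext (by push_cast; exact h3.2)⟩
  · right; right
    exact ⟨Subtype.ext (by push_cast; exact h3.1), Subtype.ext (by push_cast; exact h3.2)⟩

theorem ns_one (K : Type*) [Field K] [CharZero K] : (X0_17 K).Nonsingular (11 / 4) (-15 / 8) := by
  rw [WeierstrassCurve.Affine.nonsingular_iff', WeierstrassCurve.Affine.equation_iff]
  simp only [X0_17]
  norm_num

theorem ns_two (K : Type*) [Field K] [CharZero K] : (X0_17 K).Nonsingular 7 13 := by
  rw [WeierstrassCurve.Affine.nonsingular_iff', WeierstrassCurve.Affine.equation_iff]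
  simp only [X0_17]
  norm_num

theorem ns_three (K : Type*) [Field K] [CharZero K] : (X0_17 K).Nonsingular 7 (-21) := by
  rw [WeierstrassCurve.Affine.nonsingular_iff', WeierstrassCurve.Affine.equation_iff]
  simp only [X0_17]
  norm_num

theorem card_four {z : ℝ} (hz : z ^ 2 = 318049) : Nat.card (X0_17 ℚ⟮z⟯).Point = 4 := by
  have hb : Function.Bijective (![.zero, .some _ _ (ns_one _), .some _ _ (ns_two _),
      .some _ _ (ns_three _)] : Fin 4 → (X0_17 ℚ⟮z⟯).Point) := by
    constructor
    · intro i j hij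
      fin_cases i <;> fin_cases j <;> simp at hij ⊢ <;> norm_num at hij
    · intro P
      rcases P with _ | ⟨x, y, h⟩
      · exact ⟨0, rfl⟩
      · rcases K_pts hz h with ⟨rfl, rfl⟩ | ⟨rfl, rfl⟩ | ⟨rfl, rfl⟩
        · exact ⟨1, rfl⟩
        · exact ⟨2, rfl⟩
        · exact ⟨3, rfl⟩
  rw [← Nat.card_eq_of_bijective _ hb]
  simp

/-- The group `X₀(17)(ℚ(√318049))`, where `318049 = 47 · 67 · 101`, has exactly 4 elements
and coincides with the group `X₀(17)(ℚ)` of rational points. -/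
theorem X0_17_points_sqrt318049 (z : ℝ) (hz : z ^ 2 = 318049) :
    Nat.card (X0_17 ℚ⟮z⟯).Point = 4 ∧ PointsRational (X0_17 ℚ⟮z⟯) := by
  refine ⟨card_four hz, ?_⟩
  intro x y h
  rcases K_pts hz h with ⟨rfl, rfl⟩ | ⟨rfl, rfl⟩ | ⟨rfl, rfl⟩
  · exact ⟨⟨11 / 4, by push_cast; rfl⟩, ⟨-15 / 8, by push_cast; rfl⟩⟩
  · exact ⟨⟨7, by push_cast; rfl⟩, ⟨13, by push_cast; rfl⟩⟩
  · exact ⟨⟨7, by push_cast; rfl⟩, ⟨-21, by push_cast; rfl⟩⟩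
end

section
/- Let K = Q(√318049), where 318049 = 47 · 67 · 101. Then each of the groups X₀(11)(K) and X₀(19)(K) contains a point of infinite order. -/
open Polynomial IntermediateField NumberField

/-- `Q` is an affine point whose `x`-coordinate is rational, with `2`-adic valuation `-(k+1)`. -/
def HasVal {K : Type*} [Field K] (W : WeierstrassCurve.Affine K) (k : ℕ) (Q : W.Point) : Prop :=
  ∃ (m n : ℤ) (x y : K) (h : W.Nonsingular x y), Odd m ∧ Odd n ∧
    Q = WeierstrassCurve.Affine.Point.some x y h ∧ x * (2 ^ (k + 1) * n) = m

theorem HasVal.unique {K : Type*} [Field K] [CharZero K] {W : WeierstrassCurve.Affine K}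
    {k l : ℕ} {Q : W.Point} (h₁ : HasVal W k Q) (h₂ : HasVal W l Q) : k = l := by
  obtain ⟨m, n, x, y, h, hm, hn, hQ, hx⟩ := h₁
  obtain ⟨m', n', x', y', h', hm', hn', hQ', hx'⟩ := h₂
  rw [hQ] at hQ'
  injection hQ' with hxx hyy
  subst hxx
  have key : m * (2 ^ (l + 1) * n') = m' * (2 ^ (k + 1) * n) := by
    have : (m : K) * (2 ^ (l + 1) * n') = m' * (2 ^ (k + 1) * n) := by
      rw [← hx, ← hx']; ring
    exact_mod_cast this
  rcases lt_trichotomy k l with hlt | heq | hlt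
  · exfalso
    obtain ⟨j, rfl⟩ := Nat.exists_eq_add_of_lt hlt
    have h3 : m' * n = m * n' * 2 ^ j * 2 := by
      have : (2 : ℤ) ^ (k + 1) ≠ 0 := by positivity
      apply mul_left_cancel₀ this
      linear_combination (-1 : ℤ) * key
    have := hm'.mul hn
    rw [h3] at this
    exact (Int.not_odd_iff_even.2 (even_two.mul_left _)) this
  · exact heq
  · exfalso
    obtain ⟨j, rfl⟩ := Nat.exists_eq_add_of_lt hlt
    have h3 : m * n' = m' * n * 2 ^ j * 2 := by
      have : (2 : ℤ) ^ (l + 1) ≠ 0 := by positivity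
      apply mul_left_cancel₀ this
      linear_combination key
    have := hm.mul hn'
    rw [h3] at this
    exact (Int.not_odd_iff_even.2 (even_two.mul_left _)) this

theorem HasVal.double {K : Type*} [Field K] [CharZero K] [DecidableEq K]
    {W : WeierstrassCurve.Affine K} (a b c : ℤ)
    (h₁ : W.a₁ = 0) (h₂ : W.a₂ = a) (h₃ : W.a₃ = 1) (h₄ : W.a₄ = b) (h₆ : W.a₆ = c)
    {k : ℕ} {Q : W.Point} (hQ : HasVal W k Q) : HasVal W (k + 2) (Q + Q) := by
  obtain ⟨m, n, x, y, h, hm, hn, rfl, hx⟩ := hQ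
  set T : ℤ := 2 ^ (k + 1) * n with hT
  set N : ℤ := m ^ 3 + a * m ^ 2 * T + b * m * T ^ 2 + (1 + 4 * c) * (2 * (2 ^ k * n) ^ 3) with hN
  set M : ℤ := m ^ 4 - 2 * b * m ^ 2 * T ^ 2 - 2 * (1 + 4 * c) * m * T ^ 3
    - (4 * a * c + a - b ^ 2) * T ^ 4 with hM
  have hTe : T = 2 * (2 ^ k * n) := by rw [hT]; ring
  have hNo : Odd N := by
    have : N = m ^ 3 + 2 * (a * m ^ 2 * (2 ^ k * n) + b * m * T * (2 ^ k * n)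
        + (1 + 4 * c) * (2 ^ k * n) ^ 3) := by
      rw [hN, hTe]; ring
    rw [this]
    exact (hm.pow).add_even (even_two_mul _)
  have hMo : Odd M := by
    have : M = m ^ 4 + 2 * (- b * m ^ 2 * T ^ 2 - (1 + 4 * c) * m * T ^ 3
        - (4 * a * c + a - b ^ 2) * T ^ 3 * (2 ^ k * n)) := by
      rw [hM, hTe]; ring
    rw [this]
    exact (hm.pow).add_even (even_two_mul _)
  have hT0 : T ≠ 0 := by
    rw [hT]
    have : n ≠ 0 := by rintro rfl; simp at hn
    positivity
  have hN0 : N ≠ 0 := by rintro h0; rw [h0] at hNo; simp at hNo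
  have hTK : (T : K) ≠ 0 := by exact_mod_cast hT0
  have hNK : (N : K) ≠ 0 := by exact_mod_cast hN0
  have hx' : x * T = m := by rw [← hx, hT]; push_cast; ring
  have heq : y ^ 2 + y = x ^ 3 + a * x ^ 2 + b * x + c := by
    have := (W.equation_iff x y).1 h.1
    rw [h₁, h₂, h₃, h₄, h₆] at this
    linear_combination this
  have hN4 : (2 * y + 1) ^ 2 * T ^ 3 = 4 * N := by
    have e1 : (4 * N : K) = 4 * m ^ 3 + 4 * a * m ^ 2 * T + 4 * b * m * T ^ 2
        + (1 + 4 * c) * T ^ 3 := by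
      have : 4 * N = 4 * m ^ 3 + 4 * a * m ^ 2 * T + 4 * b * m * T ^ 2
        + (1 + 4 * c) * T ^ 3 := by rw [hN, hTe]; ring
      exact_mod_cast this
    rw [e1, ← hx']
    linear_combination 4 * T ^ 3 * heq
  have hy : 2 * y + 1 ≠ 0 := by
    intro h0
    rw [h0] at hN4
    apply hNK
    have : (4 : K) * N = 0 := by rw [← hN4]; ring
    simpa using this
  have hneg : W.negY x y = - y - 1 := by
    rw [WeierstrassCurve.Affine.negY, h₁, h₃]; ring
  have hyn : y ≠ W.negY x y := by
    rw [hneg]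
    intro h0
    apply hy
    linear_combination h0
  rw [WeierstrassCurve.Affine.Point.add_self_of_Y_ne hyn]
  refine ⟨M, n * N, _, _, _, hMo, hn.mul hNo, rfl, ?_⟩
  rw [WeierstrassCurve.Affine.slope_of_Y_ne rfl hyn, WeierstrassCurve.Affine.addX, hneg,
    h₁, h₂, h₄]
  have e2 : ((2 : K) ^ (k + 2 + 1) * ((n * N : ℤ) : K)) = (2 * y + 1) ^ 2 * T ^ 4 := by
    have : (2 : K) ^ (k + 2 + 1) * ((n * N : ℤ) : K) = T * (4 * N) := by
      rw [hT]; push_cast; ring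
    rw [this, ← hN4]; ring
  have e3 : (M : K) = (x ^ 4 - 2 * b * x ^ 2 - 2 * (1 + 4 * c) * x
      - (4 * a * c + a - b ^ 2)) * T ^ 4 := by
    rw [hM]; push_cast; rw [← hx']; ring
  rw [e2, e3]
  have hy' : y - (-y - 1) ≠ 0 := by
    intro h0; apply hy; linear_combination h0
  have e4 : ∀ L : K, L * (2 * y + 1) = 3 * x ^ 2 + 2 * a * x + b →
      (L ^ 2 + 0 * L - a - x - x) * ((2 * y + 1) ^ 2 * T ^ 4) =
      (x ^ 4 - 2 * b * x ^ 2 - 2 * (1 + 4 * c) * x - (4 * a * c + a - b ^ 2)) * T ^ 4 := by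
    intro L hL
    linear_combination (L * (2 * y + 1) + 3 * x ^ 2 + 2 * a * x + b) * T ^ 4 * hL
      - 4 * (a + 2 * x) * T ^ 4 * heq
  apply e4
  rw [div_mul_eq_mul_div, div_eq_iff hy']
  ring

theorem HasVal.infinite {K : Type*} [Field K] [CharZero K] [DecidableEq K]
    {W : WeierstrassCurve.Affine K} (a b c : ℤ)
    (h₁ : W.a₁ = 0) (h₂ : W.a₂ = a) (h₃ : W.a₃ = 1) (h₄ : W.a₄ = b) (h₆ : W.a₆ = c)
    {k : ℕ} {Q : W.Point} (hQ : HasVal W k Q) (n : ℕ) (hn : 0 < n) : n • Q ≠ 0 := by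
  intro h0
  have hv : ∀ j : ℕ, HasVal W (k + 2 * j) (2 ^ j • Q) := by
    intro j
    induction j with
    | zero => simpa using hQ
    | succ j ih =>
      have := ih.double a b c h₁ h₂ h₃ h₄ h₆
      rw [← two_nsmul, ← mul_nsmul, ← pow_succ] at this
      exact this
  have hmod : ∀ r : ℕ, r • Q = (r % n) • Q := by
    intro r
    conv_lhs => rw [← Nat.mod_add_div r n, add_nsmul, mul_nsmul, h0, nsmul_zero, add_zero]
  obtain ⟨i, j, hij, he⟩ := Finite.exists_ne_map_eq_of_infinite
    (fun j : ℕ => (⟨2 ^ j % n, Nat.mod_lt _ hn⟩ : Fin n))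
  have he' : 2 ^ i % n = 2 ^ j % n := by simpa using he
  have hi := hv i
  rw [hmod, he', ← hmod] at hi
  have := hi.unique (hv j)
  omega

theorem main_aux {K : Type*} [Field K] [CharZero K] [DecidableEq K]
    (W : WeierstrassCurve.Affine K) (a b c : ℤ)
    (h₁ : W.a₁ = 0) (h₂ : W.a₂ = a) (h₃ : W.a₃ = 1) (h₄ : W.a₄ = b) (h₆ : W.a₆ = c)
    (g : K) (hg : g ^ 2 = 318049) (m : ℤ) (k : ℕ) (n : ℤ) (s : ℚ) (hm : Odd m) (hn : Odd n)
    (hs0 : s ≠ 0)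
    (hs : 318049 * s ^ 2 = 4 * ((m : ℚ) / (2 ^ (k + 1) * n)) ^ 3
      + 4 * a * ((m : ℚ) / (2 ^ (k + 1) * n)) ^ 2
      + 4 * b * ((m : ℚ) / (2 ^ (k + 1) * n)) + (1 + 4 * c)) :
    ∃ P : W.Point, ∀ n : ℕ, 0 < n → n • P ≠ 0 := by
  have hsK : (318049 : K) * s ^ 2 = 4 * ((m : K) / (2 ^ (k + 1) * n)) ^ 3
      + 4 * a * ((m : K) / (2 ^ (k + 1) * n)) ^ 2
      + 4 * b * ((m : K) / (2 ^ (k + 1) * n)) + (1 + 4 * c) := by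
    exact_mod_cast congrArg (fun q : ℚ => (q : K)) hs
  set x : K := (m : K) / (2 ^ (k + 1) * n) with hx
  have hns : W.Nonsingular x ((-1 + s * g) / 2) := by
    rw [WeierstrassCurve.Affine.nonsingular_iff]
    refine ⟨?_, Or.inr ?_⟩
    · rw [WeierstrassCurve.Affine.equation_iff, h₁, h₂, h₃, h₄, h₆]
      linear_combination (s : K) ^ 2 / 4 * hg + hsK / 4
    · rw [h₁, h₃]
      intro h0
      have hsg : (s : K) * g = 0 := by linear_combination h0
      rcases mul_eq_zero.1 hsg with h | h
      · exact hs0 (by exact_mod_cast h)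
      · rw [h] at hg; norm_num at hg
  refine ⟨.some x _ hns, HasVal.infinite a b c h₁ h₂ h₃ h₄ h₆
    (k := k) ⟨m, n, x, _, hns, hm, hn, rfl, ?_⟩⟩
  have hn0 : (n : K) ≠ 0 := by
    have : n ≠ 0 := by rintro rfl; simp at hn
    exact_mod_cast this
  rw [hx]
  field_simp

/-- Let `K = ℚ(√318049)`, where `318049 = 47 · 67 · 101`. Then each of the groups
`X₀(11)(K)` and `X₀(19)(K)` contains a point of infinite order. -/
theorem X0_infinite_order_points_sqrt318049 (z : ℝ) (hz : z ^ 2 = 318049) :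
    (∃ P : (X0_11 ℚ⟮z⟯).Point, ∀ n : ℕ, 0 < n → n • P ≠ 0) ∧
    (∃ P : (X0_19 ℚ⟮z⟯).Point, ∀ n : ℕ, 0 < n → n • P ≠ 0) := by
  have hg : (AdjoinSimple.gen ℚ z) ^ 2 = 318049 := by
    apply Subtype.ext
    push_cast
    rw [AdjoinSimple.coe_gen]
    exact_mod_cast hz
  refine ⟨?_, ?_⟩
  · exact main_aux (X0_11 ℚ⟮z⟯) (-1) (-10) (-20) rfl (by simp [X0_11]) rfl
      (by simp [X0_11]) (by simp [X0_11]) (AdjoinSimple.gen ℚ z) hg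
      71140984825473337952869212817597839578071043 1
      21663335864453227622668092855962620575
      (87524697000717744036543983166039324579038017221269912129324183759 /
        33177684966410195962974709934090500560705102051333135241500)
      (by decide) (by decide) (by norm_num) (by norm_num)
  · exact main_aux (X0_19 ℚ⟮z⟯) (1) (-9) (-15) rfl (by simp [X0_19]) rfl
      (by simp [X0_19]) (by simp [X0_19]) (AdjoinSimple.gen ℚ z) hg
      10747761308052084825820896194603857593574273423847677203352796789 5
      2071356826242830699479966323084095819304729121103662158357725
      (111475255637694972592091291730042386725491770839772001111492671928488959547808162425360003043837 /
        42826114667223843571386136208187168708617067534718120624407563802048284350880698513649126048000)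
      (by decide) (by decide) (by norm_num) (by norm_num)
end

section
/- For each d ∈ {29, 10, 79}, each of the groups X₀(11)(Q(√d)), X₀(17)(Q(√d)) and X₀(19)(Q(√d)) contains a point of infinite order. -/
open Polynomial IntermediateField NumberField

/-!
Strategy: for each curve and each `d` we exhibit a point with rational `x`-coordinate `q` which is
not integral at `2`.  By the duplication formula, doubling strictly increases the `2`-adic absolute
value of `q` (once `|q|₂ > 4`; smaller values are handled by doubling twice first), so the points
`2 ^ k • P` are pairwise distinct, which is impossible for a torsion point.
-/

/-- Denominator of the duplication formula (the `2`-division polynomial). -/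
def dupDen (b₂ b₄ b₆ : ℤ) (q : ℚ) : ℚ := 4 * q ^ 3 + b₂ * q ^ 2 + 2 * b₄ * q + b₆

/-- Numerator of the duplication formula. -/
def dupNum (b₄ b₆ b₈ : ℤ) (q : ℚ) : ℚ := q ^ 4 - b₄ * q ^ 2 - 2 * b₆ * q - b₈

lemma norm_two_adic_two : ‖(2 : ℚ_[2])‖ = 1 / 2 := by
  have := Padic.norm_p (p := 2)
  norm_num at this ⊢
  exact this

lemma norm_int_mul_le (b : ℤ) (x : ℚ_[2]) : ‖(b : ℚ_[2]) * x‖ ≤ ‖x‖ := by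
  rw [norm_mul]
  have := Padic.norm_int_le_one (p := 2) b
  nlinarith [norm_nonneg x]

lemma norm_dupNum (b₄ b₆ b₈ : ℤ) (q : ℚ) (hq : 1 < ‖(q : ℚ_[2])‖) :
    ‖((dupNum b₄ b₆ b₈ q : ℚ) : ℚ_[2])‖ = ‖(q : ℚ_[2])‖ ^ 4 := by
  set x : ℚ_[2] := (q : ℚ_[2]) with hx
  have e : ((dupNum b₄ b₆ b₈ q : ℚ) : ℚ_[2]) =
      x ^ 4 + (((-b₄ : ℤ) : ℚ_[2]) * x ^ 2 + (((-2 * b₆ : ℤ) : ℚ_[2]) * x + ((-b₈ : ℤ) : ℚ_[2]))) := by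
    simp only [dupNum, hx]; push_cast; ring
  have h1 := norm_int_mul_le (-b₄) (x ^ 2)
  have h2 := norm_int_mul_le (-2 * b₆) x
  have h3 := Padic.norm_int_le_one (p := 2) (-b₈)
  rw [norm_pow] at h1
  have hX2 : ‖x‖ < ‖x‖ ^ 2 := by nlinarith
  have hX4 : ‖x‖ ^ 2 < ‖x‖ ^ 4 := by nlinarith
  have h5 := (Padic.nonarchimedean (((-2 * b₆ : ℤ) : ℚ_[2]) * x) ((-b₈ : ℤ) : ℚ_[2])).trans
    (max_le (h2.trans hX2.le) (h3.trans (hq.le.trans hX2.le)))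
  have h6 := (Padic.nonarchimedean (((-b₄ : ℤ) : ℚ_[2]) * x ^ 2) _).trans (max_le h1 h5)
  have h7 : ‖x ^ 4‖ = ‖x‖ ^ 4 := norm_pow _ _
  rw [e, Padic.add_eq_max_of_ne (by rw [h7]; exact (h6.trans_lt hX4).ne'), h7]
  exact max_eq_left (h6.trans hX4.le)

/-- The lower-order part of `dupDen` is at most `|q|₂ ^ 2`. -/
lemma norm_dupDen_aux (b₂ b₄ b₆ : ℤ) (q : ℚ) (hq : 1 < ‖(q : ℚ_[2])‖) :
    ∃ r : ℚ_[2], ((dupDen b₂ b₄ b₆ q : ℚ) : ℚ_[2]) = 2 * 2 * (q : ℚ_[2]) ^ 3 + r ∧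
      ‖r‖ ≤ ‖(q : ℚ_[2])‖ ^ 2 := by
  set x : ℚ_[2] := (q : ℚ_[2]) with hx
  refine ⟨(b₂ : ℚ_[2]) * x ^ 2 + (((2 * b₄ : ℤ) : ℚ_[2]) * x + (b₆ : ℚ_[2])), ?_, ?_⟩
  · simp only [dupDen, hx]; push_cast; ring
  have h1 := norm_int_mul_le b₂ (x ^ 2)
  have h2 := norm_int_mul_le (2 * b₄) x
  have h3 := Padic.norm_int_le_one (p := 2) b₆
  rw [norm_pow] at h1
  have hX2 : ‖x‖ < ‖x‖ ^ 2 := by nlinarith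
  have h5 := (Padic.nonarchimedean (((2 * b₄ : ℤ) : ℚ_[2]) * x) (b₆ : ℚ_[2])).trans
    (max_le (h2.trans hX2.le) (h3.trans (hq.le.trans hX2.le)))
  exact (Padic.nonarchimedean ((b₂ : ℚ_[2]) * x ^ 2) _).trans (max_le h1 h5)

lemma norm_four_cube (x : ℚ_[2]) : ‖2 * 2 * x ^ 3‖ = ‖x‖ ^ 3 / 4 := by
  rw [norm_mul, norm_mul, norm_pow, norm_two_adic_two]; ring

lemma dupDen_ne_zero (b₂ b₄ b₆ : ℤ) (q : ℚ) (hq : 4 < ‖(q : ℚ_[2])‖) :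
    dupDen b₂ b₄ b₆ q ≠ 0 := by
  intro h0
  obtain ⟨r, hr, hr'⟩ := norm_dupDen_aux b₂ b₄ b₆ q (by linarith)
  rw [h0, Rat.cast_zero] at hr
  have h1 : r = -(2 * 2 * (q : ℚ_[2]) ^ 3) := by linear_combination -hr
  rw [h1, norm_neg, norm_four_cube] at hr'
  have : 0 < ‖(q : ℚ_[2])‖ ^ 2 := by positivity
  nlinarith

/-- Doubling increases the `2`-adic absolute value. -/
lemma norm_dup (b₂ b₄ b₆ b₈ : ℤ) (q : ℚ) (hq : 1 < ‖(q : ℚ_[2])‖) (hD : dupDen b₂ b₄ b₆ q ≠ 0) :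
    min (4 * ‖(q : ℚ_[2])‖) (‖(q : ℚ_[2])‖ ^ 2) ≤
      ‖((dupNum b₄ b₆ b₈ q / dupDen b₂ b₄ b₆ q : ℚ) : ℚ_[2])‖ := by
  obtain ⟨r, hr, hr'⟩ := norm_dupDen_aux b₂ b₄ b₆ q hq
  have hD' : 0 < ‖((dupDen b₂ b₄ b₆ q : ℚ) : ℚ_[2])‖ := by
    rw [norm_pos_iff]; exact_mod_cast hD
  have hle : ‖((dupDen b₂ b₄ b₆ q : ℚ) : ℚ_[2])‖ ≤ max (‖(q : ℚ_[2])‖ ^ 3 / 4) (‖(q : ℚ_[2])‖ ^ 2) := by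
    rw [hr]
    refine (Padic.nonarchimedean _ _).trans ?_
    rw [norm_four_cube]
    exact max_le_max le_rfl hr'
  rw [Rat.cast_div, norm_div, norm_dupNum b₄ b₆ b₈ q hq, le_div_iff₀ hD']
  set X := ‖(q : ℚ_[2])‖
  have hX0 : 0 ≤ min (4 * X) (X ^ 2) := by positivity
  refine (mul_le_mul_of_nonneg_left hle hX0).trans ?_
  rcases max_cases (X ^ 3 / 4) (X ^ 2) with h | h <;> rw [h.1]
  · calc _ ≤ 4 * X * (X ^ 3 / 4) := mul_le_mul_of_nonneg_right (min_le_left _ _) (by positivity)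
      _ = X ^ 4 := by ring
  · calc _ ≤ X ^ 2 * X ^ 2 := mul_le_mul_of_nonneg_right (min_le_right _ _) (by positivity)
      _ = X ^ 4 := by ring

section Points

open WeierstrassCurve.Affine

variable {K : Type*} [Field K] [CharZero K] [DecidableEq K]

/-- Having a rational `x`-coordinate `q`. -/
def HasRatX {W : WeierstrassCurve.Affine K} (P : W.Point) (q : ℚ) : Prop :=
  ∃ (y : K) (h : W.Nonsingular (q : K) y), P = Point.some (q : K) y h

lemma HasRatX.unique {W : WeierstrassCurve.Affine K} {P : W.Point} {q r : ℚ}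
    (hq : HasRatX P q) (hr : HasRatX P r) : q = r := by
  obtain ⟨y, h, rfl⟩ := hq
  obtain ⟨y', h', e⟩ := hr
  have := (Point.some.inj e).1
  exact_mod_cast this

/-- The duplication formula on `x`-coordinates. -/
lemma HasRatX.double {W : WeierstrassCurve.Affine K} {b₂ b₄ b₆ b₈ : ℤ}
    (h₂ : W.b₂ = b₂) (h₄ : W.b₄ = b₄) (h₆ : W.b₆ = b₆) (h₈ : W.b₈ = b₈)
    {P : W.Point} {q : ℚ} (hP : HasRatX P q) (hD : dupDen b₂ b₄ b₆ q ≠ 0) :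
    HasRatX (2 • P) (dupNum b₄ b₆ b₈ q / dupDen b₂ b₄ b₆ q) := by
  obtain ⟨y, h, rfl⟩ := hP
  have heq := (W.equation_iff _ _).1 h.1
  have hDK : ((dupDen b₂ b₄ b₆ q : ℚ) : K) = (2 * y + W.a₁ * q + W.a₃) ^ 2 := by
    simp only [dupDen]; push_cast
    rw [← h₂, ← h₄, ← h₆]
    simp only [WeierstrassCurve.b₂, WeierstrassCurve.b₄, WeierstrassCurve.b₆]
    linear_combination -4 * heq
  have ht : 2 * y + W.a₁ * q + W.a₃ ≠ 0 := by
    intro h0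
    rw [h0] at hDK
    apply hD
    have : ((dupDen b₂ b₄ b₆ q : ℚ) : K) = 0 := by rw [hDK]; ring
    exact_mod_cast this
  have hy : y ≠ W.negY (q : K) y := by
    intro h0
    apply ht
    rw [negY] at h0
    linear_combination h0
  have hx : W.addX (q : K) (q : K) (W.slope (q : K) (q : K) y y) =
      ((dupNum b₄ b₆ b₈ q / dupDen b₂ b₄ b₆ q : ℚ) : K) := by
    rw [Rat.cast_div, hDK, slope_of_Y_ne rfl hy, addX, negY]
    have e : y - (-y - W.a₁ * (q : K) - W.a₃) = 2 * y + W.a₁ * q + W.a₃ := by ring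
    rw [e, eq_div_iff (pow_ne_zero 2 ht)]
    simp only [dupNum]; push_cast
    rw [← h₄, ← h₆, ← h₈]
    simp only [WeierstrassCurve.b₄, WeierstrassCurve.b₆, WeierstrassCurve.b₈]
    generalize hs : 2 * y + W.a₁ * (q : K) + W.a₃ = t at ht
    field_simp
    rw [← hs]
    linear_combination -(W.a₁ ^ 2 + 4 * W.a₂ + 8 * (q : K)) * heq
  rw [two_nsmul, Point.add_self_of_Y_ne hy]
  unfold HasRatX
  rw [← hx]
  exact ⟨_, _, rfl⟩

/-- All `2`-power multiples of a point with `|q|₂ > 4` have larger `|q|₂`. -/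
lemma HasRatX.pow_two {W : WeierstrassCurve.Affine K} {b₂ b₄ b₆ b₈ : ℤ}
    (h₂ : W.b₂ = b₂) (h₄ : W.b₄ = b₄) (h₆ : W.b₆ = b₆) (h₈ : W.b₈ = b₈)
    {P : W.Point} {q : ℚ} (hP : HasRatX P q) (hq : 4 < ‖(q : ℚ_[2])‖) (j : ℕ) :
    ∃ r : ℚ, HasRatX (2 ^ j • P) r ∧ ‖(q : ℚ_[2])‖ ≤ ‖(r : ℚ_[2])‖ ∧
      (0 < j → ‖(q : ℚ_[2])‖ < ‖(r : ℚ_[2])‖) := by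
  induction j with
  | zero => exact ⟨q, by simpa using hP, le_rfl, fun h => absurd h (lt_irrefl _)⟩
  | succ j ih =>
    obtain ⟨r, hr, hqr, -⟩ := ih
    have hr4 := hq.trans_le hqr
    have hD := dupDen_ne_zero b₂ b₄ b₆ r hr4
    have hlt : ‖(q : ℚ_[2])‖ < ‖((dupNum b₄ b₆ b₈ r / dupDen b₂ b₄ b₆ r : ℚ) : ℚ_[2])‖ := by
      refine lt_of_lt_of_le (lt_min ?_ ?_) (norm_dup b₂ b₄ b₆ b₈ r (by linarith) hD)
      · linarith
      · nlinarith
    refine ⟨_, ?_, hlt.le, fun _ => hlt⟩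
    rw [pow_succ', mul_nsmul']
    exact hr.double h₂ h₄ h₆ h₈ hD

lemma HasRatX.infinite_order {W : WeierstrassCurve.Affine K} {b₂ b₄ b₆ b₈ : ℤ}
    (h₂ : W.b₂ = b₂) (h₄ : W.b₄ = b₄) (h₆ : W.b₆ = b₆) (h₈ : W.b₈ = b₈)
    {P : W.Point} {q : ℚ} (hP : HasRatX P q) (hq : 4 < ‖(q : ℚ_[2])‖) (n : ℕ) (hn : 0 < n) :
    n • P ≠ 0 := by
  intro h0
  have key : ∀ k l : ℕ, k < l → ((2 ^ k : ℕ) : ZMod n) = ((2 ^ l : ℕ) : ZMod n) → False := by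
    intro k l hkl he
    rw [ZMod.natCast_eq_natCast_iff] at he
    have hdvd : addOrderOf P ∣ n := addOrderOf_dvd_of_nsmul_eq_zero h0
    have he' : 2 ^ k • P = 2 ^ l • P := nsmul_eq_nsmul_iff_modEq.2 (he.of_dvd hdvd)
    obtain ⟨r, hr, hqr, -⟩ := hP.pow_two h₂ h₄ h₆ h₈ hq k
    obtain ⟨s, hs, -, hrs⟩ := hr.pow_two h₂ h₄ h₆ h₈ (hq.trans_le hqr) (l - k)
    rw [← mul_nsmul, ← pow_add, Nat.add_sub_cancel' hkl.le, ← he'] at hs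
    have := hrs (Nat.sub_pos_of_lt hkl)
    rw [hr.unique hs] at this
    exact lt_irrefl _ this
  have : NeZero n := ⟨hn.ne'⟩
  obtain ⟨k, l, hne, he⟩ :=
    Finite.exists_ne_map_eq_of_infinite (fun k : ℕ => ((2 ^ k : ℕ) : ZMod n))
  rcases lt_or_gt_of_ne hne with h | h
  · exact key k l h he
  · exact key l k h he.symm

lemma two_le_norm (m n : ℤ) (hm : ¬ 2 ∣ m) (hn : 2 ∣ n) (hn0 : n ≠ 0) :
    2 ≤ ‖((m / n : ℚ) : ℚ_[2])‖ := by
  obtain ⟨k, rfl⟩ := hn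
  have h1 : ‖(m : ℚ_[2])‖ = 1 := by
    refine le_antisymm (Padic.norm_int_le_one m) (not_lt.1 fun h => hm ?_)
    exact_mod_cast Padic.norm_intCast_lt_one_iff.1 h
  have hk : k ≠ 0 := by rintro rfl; simp at hn0
  have hk0 : 0 < ‖(k : ℚ_[2])‖ := by rw [norm_pos_iff]; exact_mod_cast hk
  have h2 := Padic.norm_int_le_one (p := 2) k
  push_cast
  rw [norm_div, norm_mul, h1, norm_two_adic_two, le_div_iff₀ (by positivity)]
  linarith

/-- The criterion used for all nine points: the point has `x`-coordinate `m / n` and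
`2 y + a₁ x + a₃ = w √d`. -/
lemma exists_infinite_order (W : WeierstrassCurve.Affine K) (b₂ b₄ b₆ b₈ : ℤ)
    (h₂ : W.b₂ = b₂) (h₄ : W.b₄ = b₄) (h₆ : W.b₆ = b₆) (h₈ : W.b₈ = b₈)
    (d : ℕ) (s : K) (hs : s ^ 2 = d) (m n : ℤ) (w : ℚ)
    (hm : ¬ 2 ∣ m) (hn : 2 ∣ n) (hn0 : n ≠ 0)
    (hw : d * w ^ 2 = dupDen b₂ b₄ b₆ (m / n))
    (hD : dupDen b₂ b₄ b₆ (m / n) ≠ 0)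
    (hD' : dupDen b₂ b₄ b₆ (dupNum b₄ b₆ b₈ (m / n) / dupDen b₂ b₄ b₆ (m / n)) ≠ 0) :
    ∃ P : W.Point, ∀ n : ℕ, 0 < n → n • P ≠ 0 := by
  have hX := two_le_norm m n hm hn hn0
  generalize (m / n : ℚ) = q at *
  have hwK : (d : K) * (w : K) ^ 2 = 4 * (q : K) ^ 3 + W.b₂ * q ^ 2 + 2 * W.b₄ * q + W.b₆ := by
    rw [h₂, h₄, h₆]
    simp only [dupDen] at hw
    exact_mod_cast congrArg (Rat.cast : ℚ → K) hw
  have hDK : (d : K) * (w : K) ^ 2 ≠ 0 := by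
    have : ((dupDen b₂ b₄ b₆ q : ℚ) : K) ≠ 0 := by exact_mod_cast hD
    rw [← hw] at this
    exact_mod_cast this
  have hns : W.Nonsingular (q : K) ((w * s - W.a₁ * q - W.a₃) / 2) := by
    rw [nonsingular_iff', equation_iff]
    constructor
    · simp only [WeierstrassCurve.b₂, WeierstrassCurve.b₄, WeierstrassCurve.b₆] at hwK
      field_simp
      linear_combination hwK + (w : K) ^ 2 * hs
    · right
      intro h0
      apply hDK
      have h1 : (w : K) * s = 0 := by linear_combination h0
      rw [← hs]
      linear_combination (w * s) * h1
  have hP : HasRatX (Point.some _ _ hns) q := ⟨_, hns, rfl⟩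
  have h1 := norm_dup b₂ b₄ b₆ b₈ q (by linarith) hD
  have hP1 := hP.double h₂ h₄ h₆ h₈ hD
  have hX1 : 4 ≤ ‖((dupNum b₄ b₆ b₈ q / dupDen b₂ b₄ b₆ q : ℚ) : ℚ_[2])‖ :=
    (le_min (by linarith) (by nlinarith)).trans h1
  have h2 := norm_dup b₂ b₄ b₆ b₈ _ (by linarith) hD'
  have hP2 := hP1.double h₂ h₄ h₆ h₈ hD'
  exact ⟨_, hP2.infinite_order h₂ h₄ h₆ h₈
    (lt_of_lt_of_le (lt_min (by linarith) (by nlinarith)) h2)⟩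

end Points

lemma X0_11_point {K : Type*} [Field K] [CharZero K] [DecidableEq K] (d : ℕ)
    (hd : d = 29 ∨ d = 10 ∨ d = 79) (s : K) (hs : s ^ 2 = d) :
    ∃ P : (X0_11 K).Point, ∀ n : ℕ, 0 < n → n • P ≠ 0 := by
  have key := exists_infinite_order (X0_11 K) (-4) (-20) (-79) (-21)
    (by simp only [X0_11, WeierstrassCurve.b₂]; norm_num)
    (by simp only [X0_11, WeierstrassCurve.b₄]; norm_num)
    (by simp only [X0_11, WeierstrassCurve.b₆]; norm_num)
    (by simp only [X0_11, WeierstrassCurve.b₈]; norm_num) d s hs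
  rcases hd with rfl | rfl | rfl
  · exact key 907428789
      5569600
      (5059406780519 /
        6572128000)
      (by norm_num) (by norm_num) (by norm_num) (by norm_num [dupDen]) (by norm_num [dupDen])
      (by norm_num [dupDen, dupNum])
  · exact key 66529
      810
      (17042077 /
        36450)
      (by norm_num) (by norm_num) (by norm_num) (by norm_num [dupDen]) (by norm_num [dupDen])
      (by norm_num [dupDen, dupNum])
  · exact key 261837280732191692599
      8510317339816832400
      (466144606418794330075174500491 /
        12413339588068417033854084000)
      (by norm_num) (by norm_num) (by norm_num) (by norm_num [dupDen]) (by norm_num [dupDen])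
      (by norm_num [dupDen, dupNum])

lemma X0_17_point {K : Type*} [Field K] [CharZero K] [DecidableEq K] (d : ℕ)
    (hd : d = 29 ∨ d = 10 ∨ d = 79) (s : K) (hs : s ^ 2 = d) :
    ∃ P : (X0_17 K).Point, ∀ n : ℕ, 0 < n → n • P ≠ 0 := by
  have key := exists_infinite_order (X0_17 K) (-3) (-1) (-55) (41)
    (by simp only [X0_17, WeierstrassCurve.b₂]; norm_num)
    (by simp only [X0_17, WeierstrassCurve.b₄]; norm_num)
    (by simp only [X0_17, WeierstrassCurve.b₆]; norm_num)
    (by simp only [X0_17, WeierstrassCurve.b₈]; norm_num) d s hs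
  rcases hd with rfl | rfl | rfl
  · exact key 1647771152061211
      387303617642900
      (26281330138648957505367 /
        10261629682888561752250)
      (by norm_num) (by norm_num) (by norm_num) (by norm_num [dupDen]) (by norm_num [dupDen])
      (by norm_num [dupDen, dupNum])
  · exact key 1159
      360
      (21853 /
        10800)
      (by norm_num) (by norm_num) (by norm_num) (by norm_num [dupDen]) (by norm_num [dupDen])
      (by norm_num [dupDen, dupNum])
  · exact key 123420321242069279
      23830800122660958
      (52661604887796620244299305 /
        23120993092214267143562718)
      (by norm_num) (by norm_num) (by norm_num) (by norm_num [dupDen]) (by norm_num [dupDen])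
      (by norm_num [dupDen, dupNum])

lemma X0_19_point {K : Type*} [Field K] [CharZero K] [DecidableEq K] (d : ℕ)
    (hd : d = 29 ∨ d = 10 ∨ d = 79) (s : K) (hs : s ^ 2 = d) :
    ∃ P : (X0_19 K).Point, ∀ n : ℕ, 0 < n → n • P ≠ 0 := by
  have key := exists_infinite_order (X0_19 K) (4) (-18) (-59) (-140)
    (by simp only [X0_19, WeierstrassCurve.b₂]; norm_num)
    (by simp only [X0_19, WeierstrassCurve.b₄]; norm_num)
    (by simp only [X0_19, WeierstrassCurve.b₆]; norm_num)
    (by simp only [X0_19, WeierstrassCurve.b₈]; norm_num) d s hs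
  rcases hd with rfl | rfl | rfl
  · exact key 14277946942373583629804490027652686234887981158361
      1286693677563570703300595698122389250475193302500
      (10049598703454053771417119863480403497588672006141844869767256145920979017 /
        729764536734115288103847949926878757164057277789197825281725761554312500)
      (by norm_num) (by norm_num) (by norm_num) (by norm_num [dupDen]) (by norm_num [dupDen])
      (by norm_num [dupDen, dupNum])
  · exact key 1201
      10
      (41781 /
        50)
      (by norm_num) (by norm_num) (by norm_num) (by norm_num [dupDen]) (by norm_num [dupDen])
      (by norm_num [dupDen, dupNum])
  · exact key 35
      4
      (23 /
        4)
      (by norm_num) (by norm_num) (by norm_num) (by norm_num [dupDen]) (by norm_num [dupDen])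
      (by norm_num [dupDen, dupNum])

/-- For each `d ∈ {29, 10, 79}`, each of the groups `X₀(11)(ℚ(√d))`, `X₀(17)(ℚ(√d))` and
`X₀(19)(ℚ(√d))` contains a point of infinite order. -/
theorem X0_infinite_order_points (d : ℕ) (hd : d ∈ ({29, 10, 79} : Set ℕ))
    (z : ℝ) (hz : z ^ 2 = d) :
    (∃ P : (X0_11 ℚ⟮z⟯).Point, ∀ n : ℕ, 0 < n → n • P ≠ 0) ∧
    (∃ P : (X0_17 ℚ⟮z⟯).Point, ∀ n : ℕ, 0 < n → n • P ≠ 0) ∧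
    (∃ P : (X0_19 ℚ⟮z⟯).Point, ∀ n : ℕ, 0 < n → n • P ≠ 0) := by
  have hd' : d = 29 ∨ d = 10 ∨ d = 79 := by simpa using hd
  have hs : (AdjoinSimple.gen ℚ z) ^ 2 = (d : ℚ⟮z⟯) := by
    apply Subtype.ext
    simpa using hz
  exact ⟨X0_11_point d hd' _ hs, X0_17_point d hd' _ hs, X0_19_point d hd' _ hs⟩
end
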